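/- (Artin's class number formula for odd degree) Let D in F_q[T] be a square-free polynomial of odd degree M with q odd. Then L(1, chi_D) = (sqrt(q)/sqrt(|D|)) * h_D, where h_D is the order of the Picard group of O_D = F_q[T][sqrt(D)] and |D| = q^M. -/

import Mathlib

open Polynomial UniqueFactorizationMonoid
open scoped Classical

/-- The set of monic polynomials of degree `n` over a finite field is finite. -/
theorem monicSet_finite (F : Type) [Field F] [Fintype F] (n : ℕ) :
    {f : Polynomial F | f.Monic ∧ f.natDegree = n}.Finite := by
  apply Set.Finite.subset (Set.finite_range
    (fun c : Fin n → F => X ^ n + ∑ i : Fin n, C (c i) * X ^ (i : ℕ)))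
  rintro f ⟨hm, rfl⟩
  refine ⟨fun i => f.coeff i, ?_⟩
  show X ^ f.natDegree + ∑ i : Fin f.natDegree, C (f.coeff ↑i) * X ^ (i : ℕ) = f
  rw [Fin.sum_univ_eq_sum_range (fun i => C (f.coeff i) * X ^ i) f.natDegree]
  exact (hm.as_sum).symm

/-- `Mn F n` is the (finite) set of monic polynomials of degree `n` in `F[T]`. -/
noncomputable def Mn (F : Type) [Field F] [Fintype F] (n : ℕ) : Finset (Polynomial F) :=
  (monicSet_finite F n).toFinset

/-- The quadratic residue symbol `(D/P)` for `P` irreducible in `𝔽_q[T]`: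
`0` if `P ∣ D`, `1` if `D` is a nonzero square mod `P`, and `-1` otherwise. -/
noncomputable def legP {F : Type} [Field F] [Fintype F] (D P : Polynomial F) : ℤ :=
  if P ∣ D then 0
  else if IsSquare (Ideal.Quotient.mk (Ideal.span {P}) D) then 1 else -1

/-- The Jacobi symbol `χ_D(f) = (D/f)` for `𝔽_q[T]`, extended multiplicatively over the monic
irreducible factors of `f`. -/
noncomputable def jacobiP {F : Type} [Field F] [Fintype F] (D f : Polynomial F) : ℤ :=
  ((normalizedFactors f).map (fun P => legP D P)).prod

/-- The class number `h_D = |Pic(𝒪_D)|` of `𝒪_D = 𝔽_q[T][√D] = 𝔽_q[T][x]/(x² - D)`, i.e. the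
order of the ideal class group of this (Dedekind, for `D` square-free) domain. -/
noncomputable def classNumber {F : Type} [Field F] [Fintype F] (D : Polynomial F) : ℕ :=
  if h : IsDomain (AdjoinRoot ((X : Polynomial (Polynomial F)) ^ 2 - C D)) then
    Nat.card (@ClassGroup (AdjoinRoot ((X : Polynomial (Polynomial F)) ^ 2 - C D)) _ h)
  else 0

theorem mem_Mn {F : Type} [Field F] [Fintype F] {n : ℕ} {f : F[X]} :
    f ∈ Mn F n ↔ f.Monic ∧ f.natDegree = n := by
  simp [Mn]

theorem algebraMap_norm_mk_eq_prod_roots {F : Type} [Field F] [Finite F] {P : F[X]}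
    (hP : P.Monic) [Fact (Irreducible P)] (D : F[X]) :
    Algebra.norm F (AdjoinRoot.mk P D) = resultant P D P.natDegree D.natDegree := by
  have hirr : Irreducible P := Fact.out
  have hsep : P.Separable := PerfectField.separable_of_irreducible hirr
  let E := AlgebraicClosure F
  have : FiniteDimensional F (AdjoinRoot P) :=
    (AdjoinRoot.powerBasis hirr.ne_zero).finite
  apply (algebraMap F E).injective
  rw [Algebra.norm_eq_prod_embeddings, ← resultant_map_map]
  have hsplit : (P.map (algebraMap F E)).Splits := IsAlgClosed.splits _
  have h1 := resultant_eq_prod_eval (P.map (algebraMap F E)) (D.map (algebraMap F E)) D.natDegree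
    natDegree_map_le hsplit
  rw [natDegree_map] at h1
  rw [h1, (hP.map _).leadingCoeff, one_pow, one_mul]
  have hnd : (P.aroots E).Nodup := nodup_aroots_iff_of_splits hirr.ne_zero hsplit |>.2 hsep
  let S : Finset E := ⟨P.aroots E, hnd⟩
  change _ = ∏ x ∈ S, eval x (D.map (algebraMap F E))
  rw [← Finset.prod_coe_sort S (fun x => eval x (D.map (algebraMap F E)))]
  let e : (AdjoinRoot P →ₐ[F] E) ≃ {x // x ∈ S} := AdjoinRoot.equiv E F P hirr.ne_zero
  refine Fintype.prod_equiv e _ (fun x : {x // x ∈ S} => eval x.1 (D.map (algebraMap F E))) ?_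
  intro σ
  change _ = eval (σ (AdjoinRoot.powerBasis hirr.ne_zero).gen) _
  rw [AdjoinRoot.powerBasis_gen, eval_map_algebraMap, ← AdjoinRoot.aeval_eq, aeval_algHom_apply]

theorem half_pow_identity {q d : ℕ} (hq : Odd q) :
    (q ^ d - 1) / (q - 1) * (q / 2) = q ^ d / 2 := by
  obtain ⟨m, rfl⟩ := hq
  obtain ⟨s, hs⟩ : (2 * m + 1 - 1) ∣ (2 * m + 1) ^ d - 1 := by
    simpa using Nat.sub_dvd_pow_sub_pow (2 * m + 1) 1 d
  have h2 : (2 * m + 1) / 2 = m := by omega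
  have h3 : 1 ≤ (2 * m + 1) ^ d := Nat.one_le_pow _ _ (by omega)
  rcases Nat.eq_zero_or_pos m with rfl | hm
  · simp
  rw [hs, h2, Nat.mul_div_cancel_left _ (by omega)]
  have : (2 * m + 1) ^ d = 2 * (s * m) + 1 := by
    have : (2 * m + 1 - 1) * s = 2 * (s * m) := by
      rw [Nat.add_sub_cancel]; ring
    omega
  omega

theorem legP_eq_quadraticChar_resultant {F : Type} [Field F] [Fintype F]
    (hodd : Odd (Fintype.card F)) (D : F[X]) {P : F[X]} (hP : P.Monic) (hirr : Irreducible P) :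
    legP D P = quadraticChar F (resultant P D P.natDegree D.natDegree) := by
  have : Fact (Irreducible P) := ⟨hirr⟩
  have hchar : ringChar F ≠ 2 := fun h => by
    have := FiniteField.even_card_of_char_two h
    have := Nat.odd_iff.1 hodd
    omega
  have : FiniteDimensional F (AdjoinRoot P) :=
    (AdjoinRoot.powerBasis hirr.ne_zero).finite
  have : Finite (AdjoinRoot P) := Module.finite_of_finite F
  have : Fintype (AdjoinRoot P) := Fintype.ofFinite _
  rw [← algebraMap_norm_mk_eq_prod_roots hP]
  have hchar' : ringChar (AdjoinRoot P) ≠ 2 := by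
    rwa [← Algebra.ringChar_eq F (AdjoinRoot P)]
  set x : AdjoinRoot P := AdjoinRoot.mk P D with hx
  have h0 : P ∣ D ↔ x = 0 := by rw [hx, AdjoinRoot.mk_eq_zero]
  have hsq : x ≠ 0 → (IsSquare (Algebra.norm F x) ↔ IsSquare x) := fun hx0 => by
    rw [FiniteField.isSquare_iff hchar ((Algebra.norm_ne_zero_iff).2 hx0),
      FiniteField.isSquare_iff hchar' hx0, ← (algebraMap F (AdjoinRoot P)).injective.eq_iff,
      map_pow, FiniteField.algebraMap_norm_eq_pow, map_one, ← pow_mul,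
      ← Nat.card_eq_fintype_card, ← Nat.card_eq_fintype_card,
      Module.natCard_eq_pow_finrank (K := F) (V := AdjoinRoot P),
      half_pow_identity (by rwa [Nat.card_eq_fintype_card])]
  rw [legP, h0]
  split_ifs with h h'
  · simp [h]
  · rw [eq_comm, quadraticChar_one_iff_isSquare ((Algebra.norm_ne_zero_iff).2 h), hsq h]
    exact h'
  · rw [eq_comm, quadraticChar_neg_one_iff_not_isSquare, hsq h]
    exact h'

theorem jacobiP_eq_quadraticChar_resultant {F : Type} [Field F] [Fintype F]
    (hodd : Odd (Fintype.card F)) (D : F[X]) {f : F[X]} (hf : f.Monic) :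
    jacobiP D f = quadraticChar F (resultant f D f.natDegree D.natDegree) := by
  have key : ∀ s : Multiset F[X], (∀ P ∈ s, P.Monic ∧ Irreducible P) →
      (s.map (fun P => legP D P)).prod =
        quadraticChar F (resultant s.prod D s.prod.natDegree D.natDegree) ∧ s.prod.Monic := by
    intro s
    induction s using Multiset.induction with
    | empty => simp
    | cons P s ih =>
      intro h
      obtain ⟨ih, hm⟩ := ih fun Q hQ => h Q (Multiset.mem_cons_of_mem hQ)
      obtain ⟨hP, hirr⟩ := h P (Multiset.mem_cons_self _ _)
      rw [Multiset.map_cons, Multiset.prod_cons, Multiset.prod_cons, hP.natDegree_mul hm,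
        resultant_mul_left _ _ _ _ le_rfl, map_mul, ih,
        legP_eq_quadraticChar_resultant hodd D hP hirr]
      exact ⟨rfl, hP.mul hm⟩
  have h := (key (normalizedFactors f) fun P hP =>
    ⟨((Polynomial.mem_normalizedFactors_iff hf.ne_zero).1 hP).2.1, irreducible_of_normalized_factor P hP⟩).1
  rwa [prod_normalizedFactors_eq hf.ne_zero, hf.normalize_eq_self] at h

theorem sum_jacobiP_eq_zero {F : Type} [Field F] [Fintype F]
    (hodd : Odd (Fintype.card F)) {D : F[X]} (hD : D.Monic) (hM : Odd D.natDegree)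
    {n : ℕ} (hn : D.natDegree ≤ n) : ∑ f ∈ Mn F n, jacobiP D f = 0 := by
  have hchar : ringChar F ≠ 2 := fun h => by
    have := FiniteField.even_card_of_char_two h
    have := Nat.odd_iff.1 hodd
    omega
  obtain ⟨c, hc⟩ := FiniteField.exists_nonsquare hchar
  have hc0 : c ≠ 0 := by rintro rfl; exact hc (IsSquare.zero)
  have hdeg : (D * X ^ (n - D.natDegree)).natDegree = n := by
    rw [hD.natDegree_mul (monic_X_pow _), natDegree_X_pow]; omega
  have hmon : (D * X ^ (n - D.natDegree)).Monic := hD.mul (monic_X_pow _)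
  let φ : F[X] → F[X] := fun f => C c * f + D * (C (1 - c) * X ^ (n - D.natDegree))
  have hφ : Function.Injective φ := fun f g h => by
    have h' : C c * f = C c * g := add_right_cancel h
    exact mul_left_cancel₀ (by simpa using hc0) h'
  have hmem : ∀ f ∈ Mn F n, φ f ∈ Mn F n := by
    intro f hf
    obtain ⟨hf, hfn⟩ := mem_Mn.1 hf
    have heq : φ f = C c * f + C (1 - c) * (D * X ^ (n - D.natDegree)) := by
      simp only [φ]; ring
    have hle : (φ f).natDegree ≤ n := by
      rw [heq]
      refine (natDegree_add_le _ _).trans (max_le ?_ ?_)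
      · exact (natDegree_C_mul_le _ _).trans hfn.le
      · exact (natDegree_C_mul_le _ _).trans hdeg.le
    have hco : (φ f).coeff n = 1 := by
      rw [heq, coeff_add, coeff_C_mul, coeff_C_mul]
      nth_rewrite 1 [← hfn]
      nth_rewrite 2 [← hdeg]
      rw [hf.coeff_natDegree, hmon.coeff_natDegree]
      ring
    have hm := monic_of_natDegree_le_of_coeff_eq_one n hle hco
    exact mem_Mn.2 ⟨hm, le_antisymm hle (le_natDegree_of_ne_zero (by simp [hco]))⟩
  have hneg : ∀ f ∈ Mn F n, jacobiP D (φ f) = - jacobiP D f := by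
    intro f hf
    obtain ⟨hm', hn'⟩ := mem_Mn.1 (hmem f hf)
    obtain ⟨hf, hfn⟩ := mem_Mn.1 hf
    rw [jacobiP_eq_quadraticChar_resultant hodd D hm', jacobiP_eq_quadraticChar_resultant hodd D hf,
      hn', hfn, resultant_add_mul_left _ _ _ _ _ ?_ le_rfl, resultant_C_mul_left, map_mul, map_pow,
      quadraticChar_neg_one_iff_not_isSquare.2 hc, hM.neg_one_pow, neg_one_mul]
    have := natDegree_C_mul_le (1 - c) ((X : F[X]) ^ (n - D.natDegree))
    rw [natDegree_X_pow] at this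
    omega
  have h1 : ∑ f ∈ Mn F n, jacobiP D (φ f) = ∑ f ∈ Mn F n, jacobiP D f := by
    refine Finset.sum_nbij φ hmem hφ.injOn ?_ (fun _ _ => rfl)
    exact Finset.surjOn_of_injOn_of_card_le φ hmem hφ.injOn le_rfl
  rw [Finset.sum_congr rfl hneg, Finset.sum_neg_distrib] at h1
  omega

/-- The quadratic order `𝔽_q[T][√D]`, presented as pairs `re + im √D`. -/
abbrev QuadOrder {F : Type} [Field F] (D : F[X]) := QuadraticAlgebra F[X] D 0

namespace QuadOrder

variable {F : Type} [Field F] {D : F[X]}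

theorem norm_eq (z : QuadOrder D) : z.norm = z.re ^ 2 - D * z.im ^ 2 := by
  rw [QuadraticAlgebra.norm_def]; ring

theorem natDegree_norm_le_iff (hD : D.Monic) (hM : Odd D.natDegree) (z : QuadOrder D) (N : ℕ) :
    z.norm.natDegree ≤ N ↔
      2 * z.re.natDegree ≤ N ∧ (z.im = 0 ∨ 2 * z.im.natDegree + D.natDegree ≤ N) := by
  rw [norm_eq]
  by_cases him : z.im = 0
  · simp [him, natDegree_pow]
  have h1 : (z.re ^ 2).natDegree = 2 * z.re.natDegree := natDegree_pow _ _
  have h2 : (D * z.im ^ 2).natDegree = 2 * z.im.natDegree + D.natDegree := by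
    rw [hD.natDegree_mul' (pow_ne_zero _ him), natDegree_pow]; ring
  obtain ⟨k, hk⟩ := hM
  rcases lt_or_gt_of_ne (show 2 * z.re.natDegree ≠ 2 * z.im.natDegree + D.natDegree by omega)
    with h | h
  · rw [natDegree_sub_eq_right_of_natDegree_lt (by omega), h2]
    simp only [him, false_or]
    omega
  · rw [natDegree_sub_eq_left_of_natDegree_lt (by omega), h1]
    simp only [him, false_or]
    omega

theorem norm_ne_zero (hD : D.Monic) (hM : Odd D.natDegree) {z : QuadOrder D} (hz : z ≠ 0) :
    z.norm ≠ 0 := by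
  intro h
  have h1 := (natDegree_norm_le_iff hD hM z 0).1 (by simp [h])
  have him : z.im = 0 := by
    rcases h1.2 with h2 | h2
    · exact h2
    · obtain ⟨k, hk⟩ := hM; omega
  rw [norm_eq, him] at h
  have hre : z.re = 0 := by simpa using h
  exact hz (QuadraticAlgebra.ext hre him)

theorem isDomain (hD : D.Monic) (hM : Odd D.natDegree) : IsDomain (QuadOrder D) := by
  have : NoZeroDivisors (QuadOrder D) := ⟨fun {z w} h => by
    by_contra! hzw
    have := congrArg QuadraticAlgebra.norm h
    rw [map_mul, QuadraticAlgebra.norm_zero] at this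
    exact mul_ne_zero (norm_ne_zero hD hM hzw.1) (norm_ne_zero hD hM hzw.2) this⟩
  exact NoZeroDivisors.to_isDomain _

/-- Conjugation `√D ↦ -√D` as an algebra automorphism. -/
noncomputable def conj (D : F[X]) : QuadOrder D ≃ₐ[F[X]] QuadOrder D :=
  AlgEquiv.ofRingEquiv (f := starRingAut) (by
    intro r
    rw [starRingAut_apply, QuadraticAlgebra.algebraMap_eq]
    ext <;> simp)

@[simp] theorem re_conj (z : QuadOrder D) : (conj D z).re = z.re := by
  change (star z).re = _
  simp

@[simp] theorem im_conj (z : QuadOrder D) : (conj D z).im = -z.im := by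
  change (star z).im = _
  simp

@[simp] theorem conj_conj (z : QuadOrder D) : conj D (conj D z) = z := by
  ext <;> simp

theorem mul_conj (z : QuadOrder D) : z * conj D z = algebraMap F[X] (QuadOrder D) z.norm :=
  (QuadraticAlgebra.algebraMap_norm_eq_mul_star z).symm

theorem add_conj (z : QuadOrder D) : z + conj D z = algebraMap F[X] (QuadOrder D) (2 * z.re) := by
  ext <;> simp; ring

theorem algebra_norm_eq (z : QuadOrder D) : Algebra.norm F[X] z = z.norm :=
  QuadraticAlgebra.det_toLinearMap_eq_norm z

theorem algebraMap_dvd_iff {p : F[X]} {z : QuadOrder D} :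
    algebraMap F[X] (QuadOrder D) p ∣ z ↔ p ∣ z.re ∧ p ∣ z.im :=
  QuadraticAlgebra.algebraMap_dvd_iff

section Finite
variable [Finite F]

theorem finite_quotient_of_ne_bot (hD : D.Monic) (hM : Odd D.natDegree) {I : Ideal (QuadOrder D)}
    (hI : I ≠ ⊥) : Finite (QuadOrder D ⧸ I) := by
  have := isDomain hD hM
  obtain ⟨z, hz, hz0⟩ := Submodule.exists_mem_ne_zero_of_ne_bot hI
  have hn := norm_ne_zero hD hM hz0
  have hmem : algebraMap F[X] (QuadOrder D) z.norm ∈ I := by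
    rw [← mul_conj]; exact I.mul_mem_right _ hz
  set m := z.norm
  have hfin : Finite (degreeLT F m.natDegree) :=
    Finite.of_equiv _ (degreeLTEquiv F m.natDegree).toEquiv.symm
  refine Finite.of_surjective (fun x : degreeLT F m.natDegree × degreeLT F m.natDegree =>
    Ideal.Quotient.mk I ⟨x.1, x.2⟩) ?_
  intro y
  obtain ⟨w, rfl⟩ := Ideal.Quotient.mk_surjective y
  have hlt : ∀ a : F[X], a % m ∈ degreeLT F m.natDegree := fun a => by
    rw [mem_degreeLT, ← degree_eq_natDegree hn]
    exact EuclideanDomain.mod_lt a hn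
  refine ⟨⟨⟨_, hlt w.re⟩, ⟨_, hlt w.im⟩⟩, ?_⟩
  rw [Ideal.Quotient.eq, ← I.neg_mem_iff]
  have h1 : m * (w.re / m) + w.re % m = w.re := EuclideanDomain.div_add_mod _ _
  have h2 : m * (w.im / m) + w.im % m = w.im := EuclideanDomain.div_add_mod _ _
  have h3 : -((⟨w.re % m, w.im % m⟩ : QuadOrder D) - w) =
      ⟨w.re / m, w.im / m⟩ * algebraMap F[X] (QuadOrder D) m := by
    rw [QuadraticAlgebra.algebraMap_eq]
    ext1
    · simp only [QuadraticAlgebra.re_neg, QuadraticAlgebra.re_sub, QuadraticAlgebra.re_mul]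
      linear_combination -h1
    · simp only [QuadraticAlgebra.im_neg, QuadraticAlgebra.im_sub, QuadraticAlgebra.im_mul]
      linear_combination -h2
  exact h3 ▸ I.mul_mem_left _ hmem

theorem hasFiniteQuotients (hD : D.Monic) (hM : Odd D.natDegree) :
    Ring.HasFiniteQuotients (QuadOrder D) :=
  ⟨finite_quotient_of_ne_bot hD hM⟩

theorem cardQuot_span_singleton (hD : D.Monic) (hM : Odd D.natDegree) {z : QuadOrder D}
    (hz : z ≠ 0) : Submodule.cardQuot (Ideal.span {z}) = Nat.card F ^ z.norm.natDegree := by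
  have := isDomain hD hM
  have hfin := finite_quotient_of_ne_bot hD hM (I := Ideal.span {z}) (by simpa using hz)
  have : Module.Finite F (QuadOrder D ⧸ Ideal.span {z}) := Module.Finite.of_finite
  rw [Submodule.cardQuot_apply, Module.natCard_eq_pow_finrank (K := F),
    finrank_quotient_span_eq_natDegree_norm (QuadraticAlgebra.basis D 0) hz, algebra_norm_eq]

end Finite

end QuadOrder

theorem dvd_of_isIntegral_of_mul_eq {R K : Type*} [CommRing R] [IsDomain R] [IsIntegrallyClosed R]
    [Field K] [Algebra R K] (hinj : Function.Injective (algebraMap R K)) {b c : R} (hb : b ≠ 0)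
    {y : K} (hy : IsIntegral R y) (h : y * algebraMap R K b = algebraMap R K c) : b ∣ c := by
  let φ : FractionRing R →ₐ[R] K :=
    IsFractionRing.liftAlgHom (K := FractionRing R) (g := Algebra.ofId R K) hinj
  have hb' : algebraMap R (FractionRing R) b ≠ 0 := by simpa using hb
  have hφ : φ (algebraMap R (FractionRing R) c / algebraMap R (FractionRing R) b) = y := by
    have hb'' : algebraMap R K b ≠ 0 := fun h0 => hb (hinj (by simpa using h0))
    rw [map_div₀, AlgHom.commutes, AlgHom.commutes, ← h, mul_div_cancel_right₀ _ hb'']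
  rw [← hφ, isIntegral_algHom_iff φ φ.toRingHom.injective] at hy
  obtain ⟨d, hd⟩ := IsIntegrallyClosed.algebraMap_eq_of_integral hy
  refine ⟨d, FaithfulSMul.algebraMap_injective R (FractionRing R) ?_⟩
  rw [map_mul, hd, mul_div_cancel₀ _ hb']

namespace QuadOrder

variable {F : Type} [Field F] {D : F[X]}

theorem algebraMap_injective : Function.Injective (algebraMap F[X] (QuadOrder D)) := by
  intro a b h
  simpa [QuadraticAlgebra.algebraMap_eq] using congrArg QuadraticAlgebra.re h

theorem exists_eq_algebraMap_mul (h2 : (2 : F) ≠ 0) (hsf : Squarefree D) {a : F[X]} (ha : a ≠ 0)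
    {z : QuadOrder D} (htr : a ∣ 2 * z.re) (hnorm : a ^ 2 ∣ z.norm) :
    algebraMap F[X] (QuadOrder D) a ∣ z := by
  have hre : a ∣ z.re := by
    have hu : IsUnit (2 : F[X]) := by
      have : (2 : F[X]) = C 2 := (map_ofNat C 2).symm
      rw [this]
      exact isUnit_C.2 h2.isUnit
    exact (hu.dvd_mul_left).1 htr
  refine algebraMap_dvd_iff.2 ⟨hre, ?_⟩
  have h : a ^ 2 ∣ z.im ^ 2 * D := by
    have := (dvd_sub_right (pow_dvd_pow_of_dvd hre 2)).1 (norm_eq z ▸ hnorm)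
    rwa [mul_comm]
  obtain ⟨e, d, c, hrel, hce, hcd⟩ := UniqueFactorizationMonoid.exists_reduced_factors a ha z.im
  rw [← hce, ← hcd]
  have hc : c ^ 2 ≠ 0 := pow_ne_zero _ (by rintro rfl; simp_all)
  rw [← hce, ← hcd, mul_pow, mul_pow, mul_assoc, mul_dvd_mul_iff_left hc] at h
  have hu : IsUnit e := hsf e (by
    rw [← pow_two]
    exact (IsRelPrime.pow hrel).dvd_of_dvd_mul_left h)
  exact mul_dvd_mul_left c hu.dvd

theorem isIntegrallyClosed (h2 : (2 : F) ≠ 0) (hD : D.Monic) (hsf : Squarefree D)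
    (hM : Odd D.natDegree) : IsIntegrallyClosed (QuadOrder D) := by
  have := isDomain hD hM
  set K := FractionRing (QuadOrder D)
  have hinj : Function.Injective (algebraMap (QuadOrder D) K) :=
    FaithfulSMul.algebraMap_injective _ _
  have hAK : ∀ a, algebraMap F[X] K a = algebraMap (QuadOrder D) K (algebraMap F[X] _ a) :=
    fun a => IsScalarTower.algebraMap_apply _ _ _ a
  have hinjA : Function.Injective (algebraMap F[X] K) := by
    intro a b hab
    rw [hAK, hAK] at hab
    exact algebraMap_injective (hinj hab)
  rw [isIntegrallyClosed_iff K]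
  intro x hx
  obtain ⟨z, a, ha, hxa⟩ : ∃ (z : QuadOrder D) (a : F[X]), a ≠ 0 ∧
      x * algebraMap F[X] K a = algebraMap _ K z := by
    obtain ⟨u, v, hv, rfl⟩ := IsFractionRing.div_surjective (A := QuadOrder D) x
    have hv0 := nonZeroDivisors.ne_zero hv
    refine ⟨u * conj D v, v.norm, norm_ne_zero hD hM hv0, ?_⟩
    have : algebraMap _ K v ≠ 0 := by simpa using hv0
    rw [hAK, ← mul_conj, map_mul, map_mul, ← mul_assoc,
      div_mul_cancel₀ _ this]
  have hxA : IsIntegral F[X] x := isIntegral_trans x hx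
  let σ : K ≃+* K := IsFractionRing.ringEquivOfRingEquiv (conj D).toRingEquiv
  have hσ : ∀ w, σ (algebraMap _ K w) = algebraMap _ K (conj D w) := fun w =>
    IsFractionRing.ringEquivOfRingEquiv_algebraMap _ w
  have hσA : ∀ a, σ (algebraMap F[X] K a) = algebraMap F[X] K a := fun a => by
    rw [hAK, hσ, AlgEquiv.commutes]
  have hσx : IsIntegral F[X] (σ x) :=
    hxA.map (AlgEquiv.ofRingEquiv (f := σ) hσA)
  have hσxa : σ x * algebraMap F[X] K a = algebraMap _ K (conj D z) := by
    rw [← hσ, ← hxa, map_mul, hσA]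
  obtain ⟨w, rfl⟩ := exists_eq_algebraMap_mul h2 hsf ha (z := z)
    (dvd_of_isIntegral_of_mul_eq hinjA ha (hxA.add hσx) (by
      rw [add_mul, hxa, hσxa, ← map_add, add_conj, hAK]))
    (dvd_of_isIntegral_of_mul_eq hinjA (pow_ne_zero 2 ha) (hxA.mul hσx) (by
      rw [map_pow, hAK z.norm, ← mul_conj, map_mul, ← hxa, ← hσxa]; ring))
  refine ⟨w, ?_⟩
  have ha' : algebraMap F[X] K a ≠ 0 := fun h => ha (hinjA (by simpa using h))
  rw [map_mul, ← hAK, mul_comm] at hxa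
  exact (mul_left_cancel₀ ha' hxa).symm

theorem isDedekindDomain [Finite F] (h2 : (2 : F) ≠ 0) (hD : D.Monic) (hsf : Squarefree D)
    (hM : Odd D.natDegree) : IsDedekindDomain (QuadOrder D) := by
  have := isDomain hD hM
  have := hasFiniteQuotients hD hM
  have := isIntegrallyClosed h2 hD hsf hM
  have : Ring.DimensionLEOne (QuadOrder D) := inferInstance
  have : IsNoetherianRing (QuadOrder D) := inferInstance
  exact { }

end QuadOrder

/-- Multiplicativity of the ideal norm in an infinite Dedekind domain. -/
theorem Submodule.cardQuot_mul_of_infinite {S : Type*} [CommRing S] [IsDedekindDomain S]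
    [Infinite S] (I J : Ideal S) :
    Submodule.cardQuot (I * J) = Submodule.cardQuot I * Submodule.cardQuot J :=
  UniqueFactorizationMonoid.multiplicative_of_coprime Submodule.cardQuot I J
    (Submodule.cardQuot_bot _ _)
    (fun {I J} hI => by simp [Ideal.isUnit_iff.mp hI, Ideal.mul_top])
    (fun {I} i hI =>
      have : Ideal.IsPrime I := Ideal.isPrime_of_prime hI
      cardQuot_pow_of_prime hI.ne_zero)
    fun {I J} hIJ => cardQuot_mul_of_coprime <| Ideal.isCoprime_iff_sup_eq.mpr
      (Ideal.isUnit_iff.mp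
        (hIJ (Ideal.dvd_iff_le.mpr le_sup_left) (Ideal.dvd_iff_le.mpr le_sup_right)))

section InvolutionFiber

variable {α : Type*} [CommMonoidWithZero α] {σ : α →* α}

/-- The elements `x` with `x * σ x = m`. For the conjugation acting on the ideals of a quadratic
order these are the ideals of norm `m`. -/
def involutionFiber (σ : α →* α) (m : α) : Set α := {x | x * σ x = m}

theorem mem_involutionFiber {m x : α} : x ∈ involutionFiber σ m ↔ x * σ x = m := Iff.rfl

theorem dvd_of_mem_involutionFiber {m x : α} (h : x ∈ involutionFiber σ m) : x ∣ m := ⟨_, h.symm⟩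

variable [UniqueFactorizationMonoid α] [Subsingleton αˣ]

theorem involutionFiber_mul {m n : α} (hm : σ m = m) (hn : σ n = n) (hmn : IsRelPrime m n) :
    involutionFiber σ (m * n) =
      (fun x : α × α => x.1 * x.2) '' (involutionFiber σ m ×ˢ involutionFiber σ n) := by
  ext x
  simp only [Set.mem_image, Set.mem_prod, Prod.exists, mem_involutionFiber]
  constructor
  · intro h
    obtain ⟨a, b, ha, hb, rfl⟩ := exists_dvd_and_dvd_of_dvd_mul (dvd_of_mem_involutionFiber h)
    have ha' : σ a ∣ m := hm ▸ map_dvd σ ha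
    have hb' : σ b ∣ n := hn ▸ map_dvd σ hb
    have han : IsRelPrime (a * σ a) n :=
      (hmn.of_dvd_left ha).mul_left (hmn.of_dvd_left ha')
    have hbm : IsRelPrime (b * σ b) m :=
      (hmn.symm.of_dvd_left hb).mul_left (hmn.symm.of_dvd_left hb')
    have hab : (a * σ a) * (b * σ b) = m * n := by
      rw [← h, map_mul, mul_mul_mul_comm]
    refine ⟨a, b, ⟨?_, ?_⟩, rfl⟩
    · exact dvd_antisymm (han.dvd_of_dvd_mul_right ⟨_, hab.symm⟩)
        (hbm.symm.dvd_of_dvd_mul_right ⟨_, hab⟩)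
    · exact dvd_antisymm (hbm.dvd_of_dvd_mul_left ⟨a * σ a, by rw [← hab, mul_comm]⟩)
        (han.symm.dvd_of_dvd_mul_left ⟨m, by rw [hab, mul_comm]⟩)
  · rintro ⟨a, b, ⟨ha, hb⟩, rfl⟩
    rw [map_mul, mul_mul_mul_comm, ha, hb]

theorem ncard_involutionFiber_mul {m n : α} (hm : σ m = m) (hn : σ n = n)
    (hmn : IsRelPrime m n) :
    (involutionFiber σ (m * n)).ncard =
      (involutionFiber σ m).ncard * (involutionFiber σ n).ncard := by
  rw [involutionFiber_mul hm hn hmn, Set.InjOn.ncard_image, Set.ncard_prod]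
  rintro ⟨a, b⟩ ⟨ha, hb⟩ ⟨c, d⟩ ⟨hc, hd⟩ h
  replace ha := dvd_of_mem_involutionFiber ha
  replace hb := dvd_of_mem_involutionFiber hb
  replace hc := dvd_of_mem_involutionFiber hc
  replace hd := dvd_of_mem_involutionFiber hd
  change a * b = c * d at h
  have hrel : ∀ {x y : α}, x ∣ m → y ∣ n → IsRelPrime x y :=
    fun hx hy => (hmn.of_dvd_left hx).of_dvd_right hy
  refine Prod.ext (dvd_antisymm ?_ ?_) (dvd_antisymm ?_ ?_)
  · exact (hrel ha hd).dvd_of_dvd_mul_right ⟨b, h.symm⟩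
  · exact (hrel hc hb).dvd_of_dvd_mul_right ⟨d, h⟩
  · exact (hrel hc hb).symm.dvd_of_dvd_mul_left ⟨a, by rw [← h, mul_comm]⟩
  · exact (hrel ha hd).symm.dvd_of_dvd_mul_left ⟨c, by rw [h, mul_comm]⟩

theorem involutionFiber_one : involutionFiber σ 1 = {1} := by
  ext x
  rw [mem_involutionFiber, Set.mem_singleton_iff]
  constructor
  · intro h
    exact dvd_antisymm (dvd_of_mem_involutionFiber h) (one_dvd x)
  · rintro rfl; simp

theorem ncard_involutionFiber_pow_of_fixed {p : α} (hp : Prime p) (hσ : σ p = p) (k : ℕ) :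
    (involutionFiber σ (p ^ k)).ncard = if Even k then 1 else 0 := by
  have key : ∀ x, x ∈ involutionFiber σ (p ^ k) ↔ ∃ i, i + i = k ∧ x = p ^ i := by
    intro x
    constructor
    · intro h
      obtain ⟨i, -, hi⟩ := (dvd_prime_pow hp k).1 (dvd_of_mem_involutionFiber h)
      rw [associated_iff_eq] at hi
      subst hi
      rw [mem_involutionFiber, map_pow, hσ, ← pow_add] at h
      exact ⟨i, pow_injective_of_not_isUnit hp.not_isUnit hp.ne_zero h, rfl⟩
    · rintro ⟨i, rfl, rfl⟩
      rw [mem_involutionFiber, map_pow, hσ, ← pow_add]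
  split_ifs with hk
  · obtain ⟨i, rfl⟩ := hk
    rw [Set.ncard_eq_one]
    refine ⟨p ^ i, Set.ext fun x => (key x).trans ?_⟩
    constructor
    · rintro ⟨j, hj, rfl⟩
      rw [show j = i by omega, Set.mem_singleton_iff]
    · rintro rfl
      exact ⟨i, rfl, rfl⟩
  · convert Set.ncard_empty α
    refine Set.eq_empty_of_forall_notMem fun x hx => ?_
    obtain ⟨i, rfl, -⟩ := (key x).1 hx
    exact hk ⟨i, rfl⟩

theorem ncard_involutionFiber_sq_pow {p : α} (hp : Prime p) (hσ : σ p = p) (k : ℕ) :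
    (involutionFiber σ ((p * p) ^ k)).ncard = 1 := by
  rw [← pow_two, ← pow_mul, ncard_involutionFiber_pow_of_fixed hp hσ, if_pos ⟨k, by ring⟩]

theorem ncard_involutionFiber_split_pow (hσ : ∀ x, σ (σ x) = x) {p : α} (hp : Prime p)
    (hp' : Prime (σ p)) (hne : p ≠ σ p) (k : ℕ) :
    (involutionFiber σ ((p * σ p) ^ k)).ncard = k + 1 := by
  have hndvd : ¬ p ∣ σ p := fun h => hne (associated_iff_eq.1 (hp.associated_of_dvd hp' h))
  have hunit : ¬ IsUnit (p * σ p) := fun h => hp.not_isUnit (isUnit_of_mul_isUnit_left h)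
  have hconj : ∀ i j, p ^ i * (σ p) ^ j * σ (p ^ i * (σ p) ^ j) = (p * σ p) ^ (i + j) := by
    intro i j
    rw [map_mul, map_pow, map_pow, hσ, mul_pow, pow_add, pow_add]
    ac_rfl
  have key : involutionFiber σ ((p * σ p) ^ k) =
      ((fun i => p ^ i * (σ p) ^ (k - i)) '' (Finset.range (k + 1) : Set ℕ)) := by
    ext x
    simp only [Set.mem_image, Finset.coe_range, Set.mem_Iio]
    constructor
    · intro h
      have hd := dvd_of_mem_involutionFiber h
      rw [mul_pow] at hd
      obtain ⟨a, b, ha, hb, rfl⟩ := exists_dvd_and_dvd_of_dvd_mul hd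
      obtain ⟨i, -, hi⟩ := (dvd_prime_pow hp k).1 ha
      obtain ⟨j, -, hj⟩ := (dvd_prime_pow hp' k).1 hb
      rw [associated_iff_eq] at hi hj
      subst hi hj
      rw [mem_involutionFiber, hconj] at h
      have hij : i + j = k :=
        pow_injective_of_not_isUnit hunit (mul_ne_zero hp.ne_zero hp'.ne_zero) h
      exact ⟨i, by omega, by rw [show k - i = j by omega]⟩
    · rintro ⟨i, hi, rfl⟩
      rw [mem_involutionFiber, hconj, show i + (k - i) = k by omega]
  have hle : ∀ i j, p ^ i * (σ p) ^ (k - i) = p ^ j * (σ p) ^ (k - j) → j ≤ i := by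
    intro i j h
    have h1 : p ^ j ∣ p ^ i := hp.pow_dvd_of_dvd_mul_right j
      (fun hd => hndvd (hp.dvd_of_dvd_pow hd)) ⟨_, h⟩
    exact (pow_dvd_pow_iff hp.ne_zero hp.not_isUnit).1 h1
  rw [key, Set.InjOn.ncard_image, Set.ncard_coe_finset, Finset.card_range]
  intro i _ j _ h
  exact le_antisymm (hle _ _ h.symm) (hle _ _ h)

end InvolutionFiber

section MonicDivisors

variable {F : Type} [Field F] [Fintype F]

/-- The monic divisors of a non-zero polynomial. -/
noncomputable def monicDivisors (m : F[X]) : Finset F[X] :=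
  ((Finset.range (m.natDegree + 1)).biUnion (Mn F)).filter (· ∣ m)

theorem mem_monicDivisors {m f : F[X]} (hm : m ≠ 0) :
    f ∈ monicDivisors m ↔ f.Monic ∧ f ∣ m := by
  simp only [monicDivisors, Finset.mem_filter, Finset.mem_biUnion, Finset.mem_range, mem_Mn]
  constructor
  · rintro ⟨⟨n, -, h, -⟩, hd⟩
    exact ⟨h, hd⟩
  · rintro ⟨h, hd⟩
    exact ⟨⟨_, Nat.lt_succ_of_le (natDegree_le_of_dvd hd hm), h, rfl⟩, hd⟩

theorem monicDivisors_congr {m n : F[X]} (hm : m ≠ 0) (h : Associated m n) :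
    monicDivisors m = monicDivisors n := by
  ext f
  rw [mem_monicDivisors hm, mem_monicDivisors (h.ne_zero_iff.1 hm), h.dvd_iff_dvd_right]

theorem jacobiP_mul (D : F[X]) {f g : F[X]} (hf : f ≠ 0) (hg : g ≠ 0) :
    jacobiP D (f * g) = jacobiP D f * jacobiP D g := by
  rw [jacobiP, normalizedFactors_mul hf hg, Multiset.map_add, Multiset.prod_add]
  rfl

theorem jacobiP_one (D : F[X]) : jacobiP D 1 = 1 := by
  simp [jacobiP]

theorem jacobiP_pow_of_irreducible (D : F[X]) {p : F[X]} (hp : Irreducible p) (hm : p.Monic)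
    (k : ℕ) : jacobiP D (p ^ k) = legP D p ^ k := by
  rw [jacobiP, normalizedFactors_pow, normalizedFactors_irreducible hp, hm.normalize_eq_self,
    Multiset.map_nsmul, Multiset.prod_nsmul, Multiset.map_singleton, Multiset.prod_singleton]

/-- The divisor sum of the quadratic character. -/
noncomputable def divisorSum (D m : F[X]) : ℤ := ∑ f ∈ monicDivisors m, jacobiP D f

theorem divisorSum_mul (D : F[X]) {m n : F[X]} (hm : m ≠ 0) (hn : n ≠ 0) (h : IsRelPrime m n) :
    divisorSum D (m * n) = divisorSum D m * divisorSum D n := by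
  have hrel : ∀ {x y : F[X]}, x ∣ m → y ∣ n → IsRelPrime x y :=
    fun hx hy => (h.of_dvd_left hx).of_dvd_right hy
  rw [divisorSum, divisorSum, divisorSum, Finset.sum_mul_sum, ← Finset.sum_product']
  symm
  refine Finset.sum_nbij (fun x => x.1 * x.2) ?_ ?_ ?_ ?_
  · rintro ⟨f, g⟩ hfg
    rw [Finset.mem_product, mem_monicDivisors hm, mem_monicDivisors hn] at hfg
    exact (mem_monicDivisors (mul_ne_zero hm hn)).2
      ⟨hfg.1.1.mul hfg.2.1, mul_dvd_mul hfg.1.2 hfg.2.2⟩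
  · rintro ⟨a, b⟩ hab ⟨c, d⟩ hcd heq
    rw [Finset.mem_coe, Finset.mem_product, mem_monicDivisors hm, mem_monicDivisors hn] at hab hcd
    obtain ⟨⟨ha, had⟩, hb, hbd⟩ := hab
    obtain ⟨⟨hc, hcd⟩, hd, hdd⟩ := hcd
    change a * b = c * d at heq
    have h1 : a = c := eq_of_monic_of_associated ha hc (dvd_dvd_iff_associated.1
      ⟨(hrel had hdd).dvd_of_dvd_mul_right ⟨b, heq.symm⟩,
        (hrel hcd hbd).dvd_of_dvd_mul_right ⟨d, heq⟩⟩)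
    subst h1
    exact Prod.ext rfl (mul_left_cancel₀ ha.ne_zero heq)
  · intro f hf
    rw [Finset.mem_coe, mem_monicDivisors (mul_ne_zero hm hn)] at hf
    obtain ⟨a, b, ha, hb, hab⟩ := exists_dvd_and_dvd_of_dvd_mul hf.2
    have ha0 : a ≠ 0 := fun h0 => hf.1.ne_zero (by simp [hab, h0])
    have hb0 : b ≠ 0 := fun h0 => hf.1.ne_zero (by simp [hab, h0])
    refine ⟨(normalize a, normalize b), ?_, ?_⟩
    · rw [Finset.mem_coe, Finset.mem_product, mem_monicDivisors hm, mem_monicDivisors hn]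
      exact ⟨⟨monic_normalize ha0, normalize_dvd_iff.2 ha⟩,
        monic_normalize hb0, normalize_dvd_iff.2 hb⟩
    · change normalize a * normalize b = f
      rw [← normalize_mul, ← hab, hf.1.normalize_eq_self]
  · rintro ⟨f, g⟩ hfg
    rw [Finset.mem_product, mem_monicDivisors hm, mem_monicDivisors hn] at hfg
    exact (jacobiP_mul D hfg.1.1.ne_zero hfg.2.1.ne_zero).symm

theorem divisorSum_prime_pow (D : F[X]) {p : F[X]} (hp : Irreducible p) (hm : p.Monic) (k : ℕ) :
    divisorSum D (p ^ k) = ∑ i ∈ Finset.range (k + 1), legP D p ^ i := by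
  have h : monicDivisors (p ^ k) = (Finset.range (k + 1)).image (p ^ ·) := by
    ext f
    rw [mem_monicDivisors (pow_ne_zero _ hm.ne_zero), dvd_prime_pow hp.prime, Finset.mem_image]
    constructor
    · rintro ⟨hf, i, hi, hfi⟩
      exact ⟨i, by simpa [Nat.lt_succ_iff] using hi,
        (eq_of_monic_of_associated hf (hm.pow i) hfi).symm⟩
    · rintro ⟨i, hi, rfl⟩
      exact ⟨hm.pow i, i, by simpa [Nat.lt_succ_iff] using hi, Associated.refl _⟩
  rw [divisorSum, h, Finset.sum_image
    (pow_injective_of_not_isUnit hp.not_isUnit hp.ne_zero).injOn]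
  exact Finset.sum_congr rfl fun i _ => jacobiP_pow_of_irreducible D hp hm i

theorem divisorSum_of_isUnit (D : F[X]) {m : F[X]} (hm : IsUnit m) : divisorSum D m = 1 := by
  have h : monicDivisors m = {1} := by
    ext f
    rw [mem_monicDivisors hm.ne_zero, Finset.mem_singleton]
    constructor
    · rintro ⟨hf, hd⟩
      exact hf.eq_one_of_isUnit (isUnit_of_dvd_unit hd hm)
    · rintro rfl
      exact ⟨monic_one, one_dvd m⟩
  rw [divisorSum, h, Finset.sum_singleton, jacobiP_one]

end MonicDivisors

namespace QuadOrder

variable {F : Type} [Field F] {D : F[X]}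

instance : Infinite (QuadOrder D) := Infinite.of_injective _ algebraMap_injective

/-- Conjugation acting on the ideals of the quadratic order. -/
noncomputable def conjIdeal (D : F[X]) : Ideal (QuadOrder D) →* Ideal (QuadOrder D) :=
  (Ideal.mapHom (conj D) : Ideal (QuadOrder D) →+* Ideal (QuadOrder D))

theorem mem_conjIdeal {I : Ideal (QuadOrder D)} {z : QuadOrder D} :
    z ∈ conjIdeal D I ↔ conj D z ∈ I := by
  change z ∈ I.map (conj D) ↔ _
  constructor
  · intro h
    obtain ⟨w, hw, rfl⟩ := (Ideal.mem_map_iff_of_surjective _ (conj D).surjective).1 h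
    simpa using hw
  · intro h
    simpa using Ideal.mem_map_of_mem (conj D) h

theorem conjIdeal_conjIdeal (I : Ideal (QuadOrder D)) : conjIdeal D (conjIdeal D I) = I := by
  ext z
  rw [mem_conjIdeal, mem_conjIdeal, conj_conj]

theorem conjIdeal_ne_bot {I : Ideal (QuadOrder D)} (h : I ≠ ⊥) : conjIdeal D I ≠ ⊥ := by
  intro h0
  apply h
  rw [← conjIdeal_conjIdeal I, h0]
  exact Ideal.map_bot

/-- The extension to the quadratic order of the principal ideal generated by a polynomial. -/
noncomputable def polyIdeal (D m : F[X]) : Ideal (QuadOrder D) :=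
  Ideal.span {algebraMap F[X] (QuadOrder D) m}

theorem mem_polyIdeal {m : F[X]} {z : QuadOrder D} : z ∈ polyIdeal D m ↔ m ∣ z.re ∧ m ∣ z.im := by
  rw [polyIdeal, Ideal.mem_span_singleton, algebraMap_dvd_iff]

theorem polyIdeal_mul (m n : F[X]) : polyIdeal D (m * n) = polyIdeal D m * polyIdeal D n := by
  rw [polyIdeal, polyIdeal, polyIdeal, Ideal.span_singleton_mul_span_singleton, map_mul]

theorem polyIdeal_pow (m : F[X]) (k : ℕ) : polyIdeal D (m ^ k) = polyIdeal D m ^ k := by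
  rw [polyIdeal, polyIdeal, Ideal.span_singleton_pow, map_pow]

theorem polyIdeal_congr {m n : F[X]} (h : Associated m n) : polyIdeal D m = polyIdeal D n := by
  ext z
  rw [mem_polyIdeal, mem_polyIdeal, h.dvd_iff_dvd_left, h.dvd_iff_dvd_left]

theorem conjIdeal_polyIdeal (m : F[X]) : conjIdeal D (polyIdeal D m) = polyIdeal D m := by
  ext z
  rw [mem_conjIdeal, mem_polyIdeal, mem_polyIdeal, re_conj, im_conj, dvd_neg]

theorem polyIdeal_of_isUnit {m : F[X]} (h : IsUnit m) : polyIdeal D m = 1 := by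
  rw [polyIdeal, Ideal.one_eq_top, Ideal.span_singleton_eq_top]
  exact h.map _

theorem polyIdeal_ne_bot {m : F[X]} (h : m ≠ 0) : polyIdeal D m ≠ ⊥ := by
  rw [polyIdeal, Ne, Ideal.span_singleton_eq_bot]
  intro h0
  exact h (by simpa using h0)

theorem mul_conjIdeal_span_singleton (z : QuadOrder D) :
    Ideal.span {z} * conjIdeal D (Ideal.span {z}) = polyIdeal D z.norm := by
  have : conjIdeal D (Ideal.span {z}) = Ideal.span {conj D z} := by
    change Ideal.map (conj D) _ = _
    rw [Ideal.map_span, Set.image_singleton]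
  rw [this, Ideal.span_singleton_mul_span_singleton, mul_conj, polyIdeal]

theorem norm_algebraMap (m : F[X]) : (algebraMap F[X] (QuadOrder D) m).norm = m ^ 2 := by
  rw [norm_eq, QuadraticAlgebra.algebraMap_eq]
  ring

theorem cardQuot_polyIdeal [Finite F] (hD : D.Monic) (hM : Odd D.natDegree) {m : F[X]}
    (hm : m ≠ 0) : Submodule.cardQuot (polyIdeal D m) = Nat.card F ^ (2 * m.natDegree) := by
  rw [polyIdeal, cardQuot_span_singleton hD hM, norm_algebraMap, natDegree_pow]
  intro h0
  exact hm (by simpa using h0)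

theorem isRelPrime_polyIdeal {m n : F[X]} (h : IsRelPrime m n) :
    IsRelPrime (polyIdeal D m) (polyIdeal D n) := by
  intro I hm hn
  obtain ⟨u, v, huv⟩ := h.isCoprime
  rw [Ideal.isUnit_iff, Ideal.eq_top_iff_one]
  have h1 : algebraMap F[X] (QuadOrder D) (u * m + v * n) = 1 := by rw [huv, map_one]
  rw [← h1, map_add, map_mul, map_mul]
  exact I.add_mem
    (I.mul_mem_left _ (Ideal.le_of_dvd hm (Ideal.mem_span_singleton_self _)))
    (I.mul_mem_left _ (Ideal.le_of_dvd hn (Ideal.mem_span_singleton_self _)))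

theorem exists_prime_of_dvd_sq_sub [Finite F] {p b : F[X]} (hp : Irreducible p)
    (h : p ∣ b ^ 2 - D) : ∃ P : Ideal (QuadOrder D), P.IsPrime ∧
      (∀ z : QuadOrder D, z ∈ P ↔ p ∣ z.re + b * z.im) ∧
      Submodule.cardQuot P = Nat.card F ^ p.natDegree := by
  let mk := Ideal.Quotient.mk (Ideal.span {p})
  have hfin : Module.Finite F (F[X] ⧸ Ideal.span {p}) :=
    (AdjoinRoot.powerBasis hp.ne_zero).finite
  have : (Ideal.span {p}).IsPrime := (Ideal.span_singleton_prime hp.ne_zero).2 hp.prime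
  have hb : mk b * mk b = D • (1 : F[X] ⧸ Ideal.span {p}) + (0 : F[X]) • mk b := by
    rw [zero_smul, add_zero, ← Algebra.algebraMap_eq_smul_one, Ideal.Quotient.algebraMap_eq,
      ← map_mul, Ideal.Quotient.eq, Ideal.mem_span_singleton, ← pow_two]
    exact h
  let φ : QuadOrder D →ₐ[F[X]] F[X] ⧸ Ideal.span {p} := QuadraticAlgebra.lift ⟨mk b, hb⟩
  have hφ : ∀ z, φ z = mk (z.re + b * z.im) := by
    intro z
    change z.re • (1 : F[X] ⧸ Ideal.span {p}) + z.im • mk b = _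
    rw [← Algebra.algebraMap_eq_smul_one, Ideal.Quotient.algebraMap_eq]
    change mk z.re + mk (z.im * b) = _
    rw [← map_add, mul_comm]
  have hsurj : Function.Surjective φ := by
    intro y
    obtain ⟨a, rfl⟩ := Ideal.Quotient.mk_surjective y
    exact ⟨algebraMap _ _ a, φ.commutes a⟩
  refine ⟨RingHom.ker φ, RingHom.ker_isPrime φ.toRingHom, fun z => ?_, ?_⟩
  · rw [RingHom.mem_ker, hφ, Ideal.Quotient.eq_zero_iff_mem, Ideal.mem_span_singleton]
  · rw [← finrank_quotient_span_eq_natDegree (f := p), ← Module.natCard_eq_pow_finrank,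
      Submodule.cardQuot_apply]
    exact Nat.card_congr (RingHom.quotientKerEquivOfSurjective (f := φ.toRingHom) hsurj).toEquiv

theorem cardQuot_conjIdeal (I : Ideal (QuadOrder D)) :
    Submodule.cardQuot (conjIdeal D I) = Submodule.cardQuot I := by
  rw [Submodule.cardQuot_apply, Submodule.cardQuot_apply]
  exact (Nat.card_congr
    (Ideal.quotientEquiv I (conjIdeal D I) (conj D).toRingEquiv rfl).toEquiv).symm

variable [IsDedekindDomain (QuadOrder D)]

theorem eq_of_le_of_cardQuot_eq [Finite F] (hD : D.Monic) (hM : Odd D.natDegree)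
    {I J : Ideal (QuadOrder D)} (hI : I ≠ ⊥) (hle : I ≤ J)
    (h : Submodule.cardQuot I = Submodule.cardQuot J) : I = J := by
  obtain ⟨K, rfl⟩ := Ideal.dvd_iff_le.2 hle
  have hfin := finite_quotient_of_ne_bot hD hM hI
  have h0 : Submodule.cardQuot (J * K) ≠ 0 := by
    rw [Submodule.cardQuot_apply]; exact Nat.card_pos.ne'
  rw [Submodule.cardQuot_mul_of_infinite] at h h0
  have hK : Submodule.cardQuot K = 1 :=
    Nat.eq_of_mul_eq_mul_left (Nat.pos_of_ne_zero (left_ne_zero_of_mul h0)) (by rw [h, mul_one])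
  rw [Submodule.cardQuot_eq_one_iff.1 hK, Ideal.mul_top]

theorem prime_conjIdeal {P : Ideal (QuadOrder D)} (hP : Prime P) : Prime (conjIdeal D P) := by
  have := Ideal.isPrime_of_prime hP
  exact (Ideal.prime_iff_isPrime (conjIdeal_ne_bot hP.ne_zero)).2
    (Ideal.map_isPrime_of_equiv (conj D))

theorem exists_irreducible_mem [Finite F] (hD : D.Monic) (hM : Odd D.natDegree)
    {P : Ideal (QuadOrder D)} (hP : Prime P) :
    ∃ p : F[X], Irreducible p ∧ P ∣ polyIdeal D p := by
  obtain ⟨z, hz, hz0⟩ := Submodule.exists_mem_ne_zero_of_ne_bot hP.ne_zero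
  have hn := norm_ne_zero hD hM hz0
  have hdvd : P ∣ polyIdeal D z.norm := by
    rw [← mul_conjIdeal_span_singleton]
    exact (Ideal.dvd_iff_le.2 ((Ideal.span_singleton_le_iff_mem _).2 hz)).mul_right _
  generalize z.norm = m at hn hdvd
  induction m using induction_on_prime with
  | h₁ => exact absurd rfl hn
  | h₂ x hx =>
    rw [polyIdeal_of_isUnit hx] at hdvd
    exact absurd (isUnit_of_dvd_one hdvd) hP.not_isUnit
  | h₃ a p ha hp ih =>
    rw [polyIdeal_mul] at hdvd
    rcases hP.dvd_or_dvd hdvd with h | h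
    · exact ⟨p, hp.irreducible, h⟩
    · exact ih ha h

/-- The possible factorizations of an irreducible polynomial in the quadratic order: ramified,
split or inert, according to the value of the quadratic symbol. -/
theorem polyIdeal_trichotomy [Fintype F] (h2 : (2 : F) ≠ 0) (hD : D.Monic) (hM : Odd D.natDegree)
    {p : F[X]} (hp : Irreducible p) :
    (legP D p = 0 ∧ ∃ P, Prime P ∧ conjIdeal D P = P ∧ polyIdeal D p = P * P) ∨
    (legP D p = 1 ∧ ∃ P, Prime P ∧ P ≠ conjIdeal D P ∧ polyIdeal D p = P * conjIdeal D P) ∨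
    (legP D p = -1 ∧ Prime (polyIdeal D p)) := by
  have split : ∀ b, p ∣ b ^ 2 - D → ∃ P, Prime P ∧ (∀ z : QuadOrder D, z ∈ P ↔ p ∣ z.re + b * z.im)
      ∧ polyIdeal D p = P * conjIdeal D P := by
    intro b hb
    obtain ⟨P, hP, hmem, hcard⟩ := exists_prime_of_dvd_sq_sub hp hb
    have hP0 : P ≠ ⊥ := by
      rintro rfl
      refine polyIdeal_ne_bot (D := D) hp.ne_zero (eq_bot_iff.2 fun z hz => ?_)
      rw [mem_polyIdeal] at hz
      exact (hmem z).2 (dvd_add hz.1 (hz.2.mul_left b))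
    refine ⟨P, (Ideal.prime_iff_isPrime hP0).2 hP, hmem, ?_⟩
    refine (eq_of_le_of_cardQuot_eq hD hM (mul_ne_zero hP0 (conjIdeal_ne_bot hP0)) ?_ ?_).symm
    · refine Ideal.mul_le.2 fun z hz w hw => ?_
      rw [mem_conjIdeal, hmem, re_conj, im_conj] at hw
      rw [hmem] at hz
      obtain ⟨u, hu⟩ := hz
      obtain ⟨v, hv⟩ := hw
      obtain ⟨e, he⟩ := hb
      rw [mem_polyIdeal, QuadraticAlgebra.re_mul, QuadraticAlgebra.im_mul]
      refine ⟨⟨u * w.re - b * z.im * v - e * z.im * w.im, ?_⟩, ⟨u * w.im + v * z.im, ?_⟩⟩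
      · linear_combination w.re * hu - b * z.im * hv - z.im * w.im * he
      · linear_combination w.im * hu + z.im * hv
    · rw [Submodule.cardQuot_mul_of_infinite, cardQuot_conjIdeal, hcard,
        cardQuot_polyIdeal hD hM hp.ne_zero, ← pow_add, two_mul]
  by_cases hpD : p ∣ D
  · refine Or.inl ⟨if_pos hpD, ?_⟩
    obtain ⟨P, hP, hmem, hmul⟩ := split 0 (by simpa using hpD)
    have hconj : conjIdeal D P = P := by
      ext z
      rw [mem_conjIdeal, hmem, hmem, re_conj]
      simp
    exact ⟨P, hP, hconj, by rw [hmul, hconj]⟩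
  right
  by_cases hsq : IsSquare (Ideal.Quotient.mk (Ideal.span {p}) D)
  · refine Or.inl ⟨by rw [legP, if_neg hpD, if_pos hsq], ?_⟩
    obtain ⟨c, hc⟩ := hsq
    obtain ⟨b, rfl⟩ := Ideal.Quotient.mk_surjective c
    rw [← map_mul, eq_comm, Ideal.Quotient.eq, Ideal.mem_span_singleton, ← pow_two] at hc
    obtain ⟨P, hP, hmem, hmul⟩ := split b hc
    refine ⟨P, hP, fun heq => ?_, hmul⟩
    have h1 : (⟨-b, 1⟩ : QuadOrder D) ∈ P := by
      rw [hmem]; simp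
    rw [heq, mem_conjIdeal, hmem, re_conj, im_conj] at h1
    have h3 : p ∣ C 2 * b := by
      rw [← dvd_neg]
      convert h1 using 1
      simp only [map_ofNat]
      ring
    have h4 : p ∣ b := ((isUnit_C.2 h2.isUnit).dvd_mul_left).1 h3
    exact hpD ((dvd_sub_right (h4.pow two_ne_zero)).1 hc)
  · refine Or.inr ⟨by rw [legP, if_neg hpD, if_neg hsq], ?_⟩
    have key : ∀ z : QuadOrder D, p ∣ z.norm → z ∈ polyIdeal D p := by
      intro z hz
      rw [norm_eq] at hz
      have him : p ∣ z.im := by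
        by_contra him
        obtain ⟨u, v, huv⟩ := (hp.coprime_iff_not_dvd.2 him)
        refine hsq ⟨Ideal.Quotient.mk _ (v * z.re), ?_⟩
        rw [← map_mul, Ideal.Quotient.eq, Ideal.mem_span_singleton]
        obtain ⟨e, he⟩ := hz
        refine ⟨D * u * (1 + v * z.im) - v ^ 2 * e, ?_⟩
        linear_combination -v ^ 2 * he - D * (1 + v * z.im) * huv
      refine mem_polyIdeal.2 ⟨?_, him⟩
      exact hp.prime.dvd_of_dvd_pow ((dvd_sub_left ((him.pow two_ne_zero).mul_left D)).1 hz)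
    refine (Ideal.prime_iff_isPrime (polyIdeal_ne_bot hp.ne_zero)).2 ⟨?_, fun {z w} h => ?_⟩
    · rw [Ne, polyIdeal, Ideal.span_singleton_eq_top]
      intro hu
      have := (QuadraticAlgebra.isUnit_iff_norm_isUnit).1 hu
      rw [norm_algebraMap, isUnit_pow_iff two_ne_zero] at this
      exact hp.not_isUnit this
    · have hd : p ∣ (z * w).norm := by
        rw [polyIdeal, Ideal.mem_span_singleton] at h
        have := map_dvd (QuadraticAlgebra.norm (R := F[X]) (a := D) (b := 0)) h
        rw [norm_algebraMap] at this
        exact (dvd_pow_self p two_ne_zero).trans this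
      rw [map_mul] at hd
      exact (hp.prime.dvd_or_dvd hd).imp (key z) (key w)

theorem ncard_involutionFiber_polyIdeal [Fintype F] (h2 : (2 : F) ≠ 0) (hD : D.Monic)
    (hM : Odd D.natDegree) {m : F[X]} (hm : m ≠ 0) :
    ((involutionFiber (conjIdeal D) (polyIdeal D m)).ncard : ℤ) = divisorSum D m := by
  induction m using induction_on_coprime with
  | h0 => exact absurd rfl hm
  | h1 hu =>
    rw [polyIdeal_of_isUnit hu, involutionFiber_one, Set.ncard_singleton, divisorSum_of_isUnit D hu]
    rfl
  | hpr k hp =>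
    rename_i p
    have hass : Associated (normalize p ^ k) (p ^ k) := (normalize_associated p).pow_pow
    have hmon : (normalize p).Monic := monic_normalize hp.ne_zero
    have hirr : Irreducible (normalize p) := (normalize_associated p).symm.irreducible hp.irreducible
    rw [divisorSum, ← monicDivisors_congr (pow_ne_zero k hmon.ne_zero) hass, ← divisorSum,
      divisorSum_prime_pow D hirr hmon, ← polyIdeal_congr hass, polyIdeal_pow]
    rcases polyIdeal_trichotomy h2 hD hM hirr with
      ⟨hl, P, hP, hσ, h⟩ | ⟨hl, P, hP, hσ, h⟩ | ⟨hl, hP⟩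
    · rw [h, ncard_involutionFiber_sq_pow hP hσ, hl, Finset.sum_range_succ']
      simp
    · rw [h, ncard_involutionFiber_split_pow conjIdeal_conjIdeal hP (prime_conjIdeal hP) hσ, hl]
      simp
    · rw [ncard_involutionFiber_pow_of_fixed hP (conjIdeal_polyIdeal _), hl, neg_one_geom_sum]
      by_cases hk : Even k <;> simp [hk, Nat.even_add_one]
  | hcp hrel hx hy =>
    rw [polyIdeal_mul, ncard_involutionFiber_mul (conjIdeal_polyIdeal _) (conjIdeal_polyIdeal _)
      (isRelPrime_polyIdeal hrel), Nat.cast_mul, hx (left_ne_zero_of_mul hm),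
      hy (right_ne_zero_of_mul hm), divisorSum_mul D (left_ne_zero_of_mul hm)
      (right_ne_zero_of_mul hm) hrel]

theorem exists_mul_conjIdeal_eq [Fintype F] (h2 : (2 : F) ≠ 0) (hD : D.Monic)
    (hM : Odd D.natDegree) {I : Ideal (QuadOrder D)} (hI : I ≠ ⊥) :
    ∃ m : F[X], m ≠ 0 ∧ I * conjIdeal D I = polyIdeal D m := by
  induction I using induction_on_prime with
  | h₁ => exact absurd rfl hI
  | h₂ I hu => exact ⟨1, one_ne_zero, by
      rw [Ideal.isUnit_iff] at hu
      rw [hu, ← Ideal.one_eq_top, map_one, one_mul, polyIdeal_of_isUnit isUnit_one]⟩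
  | h₃ I P hI0 hP ih =>
    obtain ⟨m, hm, hIm⟩ := ih hI0
    suffices ∃ n : F[X], n ≠ 0 ∧ P * conjIdeal D P = polyIdeal D n by
      obtain ⟨n, hn, hPn⟩ := this
      exact ⟨n * m, mul_ne_zero hn hm, by
        rw [map_mul, mul_mul_mul_comm, hIm, hPn, polyIdeal_mul]⟩
    obtain ⟨p, hp, hPp⟩ := exists_irreducible_mem hD hM hP
    rcases polyIdeal_trichotomy h2 hD hM hp with
      ⟨-, R, hR, hσ, h⟩ | ⟨-, R, hR, -, h⟩ | ⟨-, hR⟩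
    · rw [h] at hPp
      have hPR : P = R := associated_iff_eq.1
        (hP.associated_of_dvd hR ((hP.dvd_or_dvd hPp).elim id id))
      exact ⟨p, hp.ne_zero, by rw [hPR, hσ, h]⟩
    · rw [h] at hPp
      refine ⟨p, hp.ne_zero, ?_⟩
      rcases hP.dvd_or_dvd hPp with h' | h'
      · rw [associated_iff_eq.1 (hP.associated_of_dvd hR h'), h]
      · rw [associated_iff_eq.1 (hP.associated_of_dvd (prime_conjIdeal hR) h'),
          conjIdeal_conjIdeal, mul_comm, h]
    · refine ⟨p * p, mul_ne_zero hp.ne_zero hp.ne_zero, ?_⟩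
      rw [associated_iff_eq.1 (hP.associated_of_dvd hR hPp), conjIdeal_polyIdeal, polyIdeal_mul]

end QuadOrder

section MonicCount

variable {F : Type} [Field F]

theorem natCard_degreeLT [Finite F] (n : ℕ) : Nat.card (degreeLT F n) = Nat.card F ^ n := by
  rw [Nat.card_congr (degreeLTEquiv F n).toEquiv, Nat.card_fun, Nat.card_fin]

theorem card_Mn [Fintype F] (n : ℕ) : (Mn F n).card = Nat.card F ^ n := by
  rw [← natCard_degreeLT, ← Nat.card_eq_finsetCard]
  have hmem : ∀ g : degreeLT F n, X ^ n + (g : F[X]) ∈ Mn F n := fun g =>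
    mem_Mn.2 ⟨monic_X_pow_add (mem_degreeLT.1 g.2),
      natDegree_eq_of_degree_eq_some (by
        rw [degree_add_eq_left_of_degree_lt, degree_X_pow]
        rw [degree_X_pow]
        exact mem_degreeLT.1 g.2)⟩
  symm
  refine Nat.card_eq_of_bijective (fun g => ⟨X ^ n + (g : F[X]), hmem g⟩) ⟨fun g g' h => ?_, ?_⟩
  · exact Subtype.ext (add_left_cancel (congrArg Subtype.val h))
  · rintro ⟨f, hf⟩
    obtain ⟨hmon, rfl⟩ := mem_Mn.1 hf
    refine ⟨⟨f - X ^ f.natDegree, mem_degreeLT.2 ?_⟩, Subtype.ext (add_sub_cancel _ _)⟩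
    rw [← degree_eq_natDegree hmon.ne_zero]
    refine degree_sub_lt_left ?_ hmon.ne_zero ?_
    · rw [degree_X_pow, degree_eq_natDegree hmon.ne_zero]
    · rw [hmon.leadingCoeff, leadingCoeff_X_pow]

theorem card_filter_dvd_Mn [Fintype F] {f : F[X]} (hf : f.Monic) {n : ℕ} (hn : f.natDegree ≤ n) :
    ((Mn F n).filter (f ∣ ·)).card = Nat.card F ^ (n - f.natDegree) := by
  rw [← card_Mn]
  symm
  refine Finset.card_nbij (f * ·) ?_ ?_ ?_
  · intro g hg
    rw [Finset.mem_coe, mem_Mn] at hg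
    rw [Finset.mem_coe, Finset.mem_filter, mem_Mn]
    exact ⟨⟨hf.mul hg.1, by rw [hf.natDegree_mul hg.1, hg.2]; omega⟩, dvd_mul_right f g⟩
  · exact (mul_right_injective₀ hf.ne_zero).injOn
  · rintro m hm
    rw [Finset.mem_coe, Finset.mem_filter, mem_Mn] at hm
    obtain ⟨⟨hm, hmn⟩, g, rfl⟩ := hm
    have hg : g.Monic := hf.of_mul_monic_left hm
    rw [hf.natDegree_mul hg] at hmn
    exact ⟨g, mem_Mn.2 ⟨hg, by omega⟩, rfl⟩

theorem sum_divisorSum [Fintype F] (D : F[X]) (n : ℕ) :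
    ∑ m ∈ Mn F n, divisorSum D m =
      ∑ k ∈ Finset.range (n + 1), (∑ f ∈ Mn F k, jacobiP D f) * (Nat.card F : ℤ) ^ (n - k) := by
  have hdis : ∀ i ∈ Finset.range (n + 1), ∀ j ∈ Finset.range (n + 1), i ≠ j →
      Disjoint (Mn F i) (Mn F j) := by
    intro i _ j _ hij
    rw [Finset.disjoint_left]
    intro f hi hj
    exact hij ((mem_Mn.1 hi).2.symm.trans (mem_Mn.1 hj).2)
  simp only [divisorSum]
  rw [Finset.sum_comm' (s' := fun f => (Mn F n).filter (f ∣ ·))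
    (t' := (Finset.range (n + 1)).biUnion (Mn F)), Finset.sum_biUnion hdis]
  · refine Finset.sum_congr rfl fun k hk => ?_
    rw [Finset.sum_mul]
    refine Finset.sum_congr rfl fun f hf => ?_
    obtain ⟨hfm, rfl⟩ := mem_Mn.1 hf
    rw [Finset.sum_const, card_filter_dvd_Mn hfm (by simpa [Nat.lt_succ_iff] using hk), nsmul_eq_mul,
      mul_comm, Nat.cast_pow]
  · intro m f
    constructor
    · rintro ⟨hm, hf⟩
      obtain ⟨hmm, rfl⟩ := mem_Mn.1 hm
      rw [mem_monicDivisors hmm.ne_zero] at hf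
      refine ⟨Finset.mem_filter.2 ⟨hm, hf.2⟩, Finset.mem_biUnion.2 ⟨f.natDegree, ?_, ?_⟩⟩
      · exact Finset.mem_range.2 (Nat.lt_succ_of_le (natDegree_le_of_dvd hf.2 hmm.ne_zero))
      · exact mem_Mn.2 ⟨hf.1, rfl⟩
    · rintro ⟨hm, hf⟩
      obtain ⟨hm, hd⟩ := Finset.mem_filter.1 hm
      obtain ⟨k, -, hf⟩ := Finset.mem_biUnion.1 hf
      exact ⟨hm, (mem_monicDivisors (mem_Mn.1 hm).1.ne_zero).2 ⟨(mem_Mn.1 hf).1, hd⟩⟩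

end MonicCount

namespace QuadOrder

variable {F : Type} [Field F] {D : F[X]}

/-- The ideals of the quadratic order with residue ring of cardinality `q ^ n`. -/
def idealsOfDegree (D : F[X]) (n : ℕ) : Set (Ideal (QuadOrder D)) :=
  {I | Submodule.cardQuot I = Nat.card F ^ n}

theorem idealsOfDegree_ne_bot [Finite F] {n : ℕ} {I : Ideal (QuadOrder D)}
    (h : I ∈ idealsOfDegree D n) : I ≠ ⊥ := by
  rintro rfl
  change Submodule.cardQuot _ = _ at h
  rw [Submodule.cardQuot_bot] at h
  exact (pow_pos Nat.card_pos n).ne h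

theorem finite_idealsOfDegree [Finite F] (hD : D.Monic) (hM : Odd D.natDegree) (n : ℕ) :
    (idealsOfDegree D n).Finite := by
  have := hasFiniteQuotients hD hM
  refine (Ring.HasFiniteQuotients.finite_cardQuot_le (R := QuadOrder D) (Nat.card F ^ n)).subset ?_
  intro I hI
  exact le_of_eq hI

variable [IsDedekindDomain (QuadOrder D)]

theorem cardQuot_of_mem_involutionFiber [Finite F] (hD : D.Monic) (hM : Odd D.natDegree) {m : F[X]}
    (hm : m ≠ 0) {I : Ideal (QuadOrder D)}
    (h : I ∈ involutionFiber (conjIdeal D) (polyIdeal D m)) :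
    Submodule.cardQuot I = Nat.card F ^ m.natDegree := by
  have h1 := congrArg Submodule.cardQuot h
  rw [Submodule.cardQuot_mul_of_infinite, cardQuot_conjIdeal, cardQuot_polyIdeal hD hM hm,
    two_mul, pow_add, ← pow_two, ← pow_two] at h1
  exact Nat.pow_left_injective two_ne_zero h1

theorem mem_idealsOfDegree_iff [Fintype F] (h2 : (2 : F) ≠ 0) (hD : D.Monic)
    (hM : Odd D.natDegree) {n : ℕ} {I : Ideal (QuadOrder D)} :
    I ∈ idealsOfDegree D n ↔ ∃ m ∈ Mn F n, I ∈ involutionFiber (conjIdeal D) (polyIdeal D m) := by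
  constructor
  · intro h
    obtain ⟨m, hm, hI⟩ := exists_mul_conjIdeal_eq h2 hD hM (idealsOfDegree_ne_bot h)
    rw [← polyIdeal_congr (normalize_associated m)] at hI
    have hmon : (normalize m).Monic := monic_normalize hm
    refine ⟨normalize m, mem_Mn.2 ⟨hmon, ?_⟩, hI⟩
    have h1 := (cardQuot_of_mem_involutionFiber hD hM hmon.ne_zero hI).symm.trans h
    exact Nat.pow_right_injective Finite.one_lt_card h1
  · rintro ⟨m, hm, hI⟩
    obtain ⟨hmon, rfl⟩ := mem_Mn.1 hm
    exact cardQuot_of_mem_involutionFiber hD hM hmon.ne_zero hI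

theorem ncard_idealsOfDegree_eq_sum [Fintype F] (h2 : (2 : F) ≠ 0) (hD : D.Monic)
    (hM : Odd D.natDegree) (n : ℕ) :
    ((idealsOfDegree D n).ncard : ℤ) = ∑ m ∈ Mn F n, divisorSum D m := by
  have hfin := finite_idealsOfDegree (D := D) hD hM n
  have hsub : ∀ m ∈ Mn F n, involutionFiber (conjIdeal D) (polyIdeal D m) ⊆ idealsOfDegree D n :=
    fun m hm I hI => (mem_idealsOfDegree_iff h2 hD hM).2 ⟨m, hm, hI⟩
  have hdis : (Mn F n : Set F[X]).PairwiseDisjoint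
      (fun m => hfin.toFinset.filter (· ∈ involutionFiber (conjIdeal D) (polyIdeal D m))) := by
    intro m hm m' hm' hne
    rw [Function.onFun, Finset.disjoint_left]
    intro I hI hI'
    replace hI := (Finset.mem_filter.1 hI).2
    replace hI' := (Finset.mem_filter.1 hI').2
    apply hne
    have heq : polyIdeal D m = polyIdeal D m' := hI.symm.trans hI'
    have hself : ∀ a : F[X], algebraMap F[X] (QuadOrder D) a ∈ polyIdeal D a :=
      fun a => Ideal.mem_span_singleton_self _
    refine eq_of_monic_of_associated (mem_Mn.1 hm).1 (mem_Mn.1 hm').1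
      (dvd_dvd_iff_associated.1 ⟨?_, ?_⟩)
    · have := (mem_polyIdeal.1 (heq ▸ hself m')).1
      simpa using this
    · have := (mem_polyIdeal.1 (heq ▸ hself m)).1
      simpa using this
  have hunion : hfin.toFinset = (Mn F n).biUnion
      (fun m => hfin.toFinset.filter (· ∈ involutionFiber (conjIdeal D) (polyIdeal D m))) := by
    ext I
    simp only [Set.Finite.mem_toFinset, Finset.mem_biUnion, Finset.mem_filter]
    constructor
    · intro h
      obtain ⟨m, hm, hI⟩ := (mem_idealsOfDegree_iff h2 hD hM).1 h
      exact ⟨m, hm, h, hI⟩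
    · rintro ⟨-, -, h, -⟩
      exact h
  rw [Set.ncard_eq_toFinset_card _ hfin, hunion, Finset.card_biUnion hdis, Nat.cast_sum]
  refine Finset.sum_congr rfl fun m hm => ?_
  rw [← ncard_involutionFiber_polyIdeal h2 hD hM (mem_Mn.1 hm).1.ne_zero, ← Set.ncard_coe_finset]
  congr 2
  ext I
  simp only [Finset.coe_filter, Set.Finite.mem_toFinset, Set.mem_ofPred_eq]
  exact ⟨And.right, fun h => ⟨hsub m hm h, h⟩⟩

theorem ncard_idealsOfDegree [Fintype F] (hodd : Odd (Fintype.card F)) (h2 : (2 : F) ≠ 0)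
    (hD : D.Monic) (hM : Odd D.natDegree) {n : ℕ} (hn : D.natDegree ≤ n) :
    ((idealsOfDegree D n).ncard : ℝ) = (Fintype.card F : ℝ) ^ n *
      ∑ k ∈ Finset.range D.natDegree,
        (∑ f ∈ Mn F k, (jacobiP D f : ℝ)) * (Fintype.card F : ℝ) ^ (-(k : ℤ)) := by
  have h := ncard_idealsOfDegree_eq_sum h2 hD hM n
  rw [sum_divisorSum, ← Finset.sum_subset (Finset.range_mono (show D.natDegree ≤ n + 1 by omega))
    (fun k _ hk => by
      rw [sum_jacobiP_eq_zero hodd hD hM (by simpa using hk), zero_mul])] at h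
  have h' := congrArg (Int.cast : ℤ → ℝ) h
  rw [Int.cast_natCast] at h'
  rw [h', Finset.mul_sum, Int.cast_sum]
  refine Finset.sum_congr rfl fun k hk => ?_
  have hq : (Fintype.card F : ℝ) ≠ 0 := by simp
  have hk' : k ≤ n := by have := Finset.mem_range.1 hk; omega
  push_cast
  rw [Nat.card_eq_fintype_card, pow_sub₀ _ hq hk', zpow_neg, zpow_natCast]
  ring

end QuadOrder

namespace QuadOrder

variable {F : Type} [Field F] {D : F[X]}

/-- The elements whose two coordinates have degree less than `a` and `b`. -/
def degreeBox (D : F[X]) (a b : ℕ) : AddSubgroup (QuadOrder D) where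
  carrier := {z | z.re ∈ degreeLT F a ∧ z.im ∈ degreeLT F b}
  zero_mem' := ⟨zero_mem _, zero_mem _⟩
  add_mem' hz hw := ⟨add_mem hz.1 hw.1, add_mem hz.2 hw.2⟩
  neg_mem' hz := ⟨neg_mem hz.1, neg_mem hz.2⟩

theorem mem_degreeBox {a b : ℕ} {z : QuadOrder D} :
    z ∈ degreeBox D a b ↔ z.re ∈ degreeLT F a ∧ z.im ∈ degreeLT F b :=
  Iff.rfl

theorem natCard_degreeBox [Finite F] (a b : ℕ) :
    Nat.card (degreeBox D a b) = Nat.card F ^ (a + b) := by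
  rw [pow_add, ← natCard_degreeLT, ← natCard_degreeLT, ← Nat.card_prod]
  exact Nat.card_congr
    { toFun := fun z => (⟨z.1.re, z.2.1⟩, ⟨z.1.im, z.2.2⟩)
      invFun := fun p => ⟨⟨p.1.1, p.2.1⟩, p.1.2, p.2.2⟩
      left_inv := fun _ => rfl
      right_inv := fun _ => rfl }

theorem natDegree_norm_le_iff_mem_degreeBox (hD : D.Monic) (hM : Odd D.natDegree)
    {N : ℕ} (hN : D.natDegree ≤ N + 2) {z : QuadOrder D} :
    z.norm.natDegree ≤ N ↔ z ∈ degreeBox D (N / 2 + 1) ((N + 2 - D.natDegree) / 2) := by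
  have hlt : ∀ {f : F[X]} {k : ℕ}, f ∈ degreeLT F k ↔ f = 0 ∨ f.natDegree < k := by
    intro f k
    rw [mem_degreeLT]
    rcases eq_or_ne f 0 with rfl | hf
    · simp
    · rw [natDegree_lt_iff_degree_lt hf, or_iff_right hf]
  rw [natDegree_norm_le_iff hD hM, mem_degreeBox, hlt, hlt]
  refine and_congr ⟨fun h => Or.inr (by omega), ?_⟩ (or_congr Iff.rfl (by omega))
  rintro (h | h)
  · simp [h]
  · omega

theorem natCard_inf_degreeBox [Finite F] {J : Ideal (QuadOrder D)} {a b d : ℕ}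
    (hJ : Submodule.cardQuot J = Nat.card F ^ d) (hsup : J.toAddSubgroup ⊔ degreeBox D a b = ⊤) :
    Nat.card (J.toAddSubgroup ⊓ degreeBox D a b : AddSubgroup (QuadOrder D)) * Nat.card F ^ d =
      Nat.card F ^ (a + b) := by
  rw [← hJ, ← natCard_degreeBox (D := D), Submodule.cardQuot, ← AddSubgroup.relIndex_top_right, ← hsup,
    sup_comm, AddSubgroup.relIndex_sup_right, ← AddSubgroup.inf_relIndex_right, AddSubgroup.relIndex,
    ← Nat.card_congr (AddSubgroup.addSubgroupOfEquivOfLe (inf_le_right (a := J.toAddSubgroup)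
      (b := degreeBox D a b))).toEquiv]
  exact AddSubgroup.card_mul_index _

theorem exists_sup_degreeBox_eq_top [Finite F] (hD : D.Monic) (hM : Odd D.natDegree)
    {J : Ideal (QuadOrder D)} (hJ : J ≠ ⊥) :
    ∃ N₀, ∀ N ≥ N₀, D.natDegree ≤ N + 2 ∧
      J.toAddSubgroup ⊔ degreeBox D (N / 2 + 1) ((N + 2 - D.natDegree) / 2) = ⊤ := by
  have := finite_quotient_of_ne_bot hD hM hJ
  obtain ⟨B, hB⟩ := (Set.finite_range fun x : QuadOrder D ⧸ J => (x.out.norm).natDegree).bddAbove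
  refine ⟨max B D.natDegree, fun N hN => ?_⟩
  have hN2 : D.natDegree ≤ N + 2 := by have := le_max_right B D.natDegree; omega
  refine ⟨hN2, eq_top_iff.2 fun z _ => ?_⟩
  set x : QuadOrder D ⧸ J := Ideal.Quotient.mk J z
  have h1 : z - x.out ∈ J := by
    rw [← Ideal.Quotient.eq_zero_iff_mem, map_sub, sub_eq_zero]
    exact (Quotient.out_eq x).symm
  have h2 : x.out ∈ degreeBox D (N / 2 + 1) ((N + 2 - D.natDegree) / 2) :=
    (natDegree_norm_le_iff_mem_degreeBox hD hM hN2).1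
      ((hB ⟨x, rfl⟩).trans ((le_max_left _ _).trans hN))
  rw [← sub_add_cancel z x.out]
  exact add_mem (AddSubgroup.mem_sup_left (S := J.toAddSubgroup) h1) (AddSubgroup.mem_sup_right h2)

theorem ncard_natDegree_norm_eq [Finite F] (hD : D.Monic) (hM : Odd D.natDegree)
    {J : Ideal (QuadOrder D)} (hJ : J ≠ ⊥) {d : ℕ} (hd : Submodule.cardQuot J = Nat.card F ^ d) :
    ∃ N₀, ∀ N ≥ N₀, {z | z ∈ J ∧ z.norm.natDegree = N + d}.ncard *
      Nat.card F ^ (D.natDegree / 2) = (Nat.card F - 1) * Nat.card F ^ N := by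
  obtain ⟨N₀, h⟩ := exists_sup_degreeBox_eq_top hD hM hJ
  refine ⟨N₀ + D.natDegree + 1, fun N hN => ?_⟩
  have hq : 0 < Nat.card F := Nat.card_pos
  set A : ℕ → Set (QuadOrder D) := fun K => {z | z ∈ J ∧ z.norm.natDegree ≤ K}
  have hcard : ∀ K ≥ N₀, D.natDegree ≤ K → (A K).Finite ∧ (A K).ncard *
      Nat.card F ^ d * Nat.card F ^ (D.natDegree / 2) = Nat.card F ^ (K + 1) := by
    intro K hK hDK
    have h1 := natCard_inf_degreeBox hd (h K hK).2
    have h2 : A K = ((J.toAddSubgroup ⊓ degreeBox D (K / 2 + 1) ((K + 2 - D.natDegree) / 2) :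
        AddSubgroup (QuadOrder D)) : Set (QuadOrder D)) := by
      ext z
      exact and_congr Iff.rfl (natDegree_norm_le_iff_mem_degreeBox hD hM (h K hK).1)
    have h3 : Nat.card (A K) * Nat.card F ^ d =
        Nat.card F ^ (K / 2 + 1 + (K + 2 - D.natDegree) / 2) := by
      rw [h2]
      exact h1
    refine ⟨Set.finite_coe_iff.1 (Nat.finite_of_card_ne_zero fun h0 => ?_), ?_⟩
    · rw [h0, zero_mul] at h3
      exact (pow_pos hq _).ne h3
    · rw [← Nat.card_coe_set_eq, h3, ← pow_add]
      obtain ⟨g, hg⟩ := hM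
      congr 1
      omega
  obtain ⟨hfin, h1⟩ := hcard (N + d - 1) (by omega) (by omega)
  have h2 := (hcard (N + d) (by omega) (by omega)).2
  have hdiff : {z | z ∈ J ∧ z.norm.natDegree = N + d} = A (N + d) \ A (N + d - 1) := by
    ext z
    constructor
    · rintro ⟨hz, hn⟩
      exact ⟨⟨hz, hn.le⟩, fun hz' => by have := hz'.2; omega⟩
    · rintro ⟨⟨hz, hn⟩, hz'⟩
      exact ⟨hz, le_antisymm hn (by by_contra! hlt; exact hz' ⟨hz, by omega⟩)⟩
  have hsub : A (N + d - 1) ⊆ A (N + d) := fun z hz => ⟨hz.1, hz.2.trans (Nat.sub_le _ _)⟩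
  rw [hdiff, Set.ncard_sdiff hsub hfin,
    Nat.sub_mul, Nat.sub_mul, one_mul]
  rw [mul_right_comm, add_right_comm, pow_add] at h2
  rw [mul_right_comm, Nat.sub_add_cancel (by omega), pow_add] at h1
  have h1' := Nat.eq_of_mul_eq_mul_right (pow_pos hq d) h1
  have h2' := Nat.eq_of_mul_eq_mul_right (pow_pos hq d) h2
  rw [h1', h2', pow_succ, mul_comm]

theorem isUnit_iff (hD : D.Monic) (hM : Odd D.natDegree) {z : QuadOrder D} :
    IsUnit z ↔ ∃ u : Fˣ, z = algebraMap F[X] (QuadOrder D) (C (u : F)) := by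
  constructor
  · intro h
    have h0 := natDegree_eq_zero_of_isUnit (QuadraticAlgebra.isUnit_iff_norm_isUnit.1 h)
    obtain ⟨h1, h2⟩ := (natDegree_norm_le_iff hD hM z 0).1 h0.le
    have him : z.im = 0 := h2.resolve_right (by have := hM.pos; omega)
    have hz : z = algebraMap F[X] (QuadOrder D) (C (z.re.coeff 0)) := by
      rw [← eq_C_of_natDegree_eq_zero (by omega)]
      ext
      · simp
      · simp [him]
    have hne : z.re.coeff 0 ≠ 0 := by
      rintro h0
      rw [h0, C_0, map_zero] at hz
      have := isDomain hD hM
      exact h.ne_zero hz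
    exact ⟨Units.mk0 _ hne, hz⟩
  · rintro ⟨u, rfl⟩
    exact (u.isUnit.map C).map _

/-- The nonzero principal ideals contained in `J` with residue ring of cardinality `q ^ N`. -/
def principalIdealsOfDegree (J : Ideal (QuadOrder D)) (N : ℕ) : Set (Ideal (QuadOrder D)) :=
  {K | K ≤ J ∧ K.IsPrincipal ∧ Submodule.cardQuot K = Nat.card F ^ N}

theorem ncard_natDegree_norm_eq_mul [Finite F] (hD : D.Monic) (hM : Odd D.natDegree)
    (J : Ideal (QuadOrder D)) {N : ℕ} (hN : N ≠ 0) :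
    {z | z ∈ J ∧ z.norm.natDegree = N}.ncard =
      (Nat.card F - 1) * (principalIdealsOfDegree J N).ncard := by
  have := isDomain hD hM
  have hspan : ∀ {z : QuadOrder D}, z.norm.natDegree = N → z ≠ 0 := by
    rintro z h rfl
    simp at h
    exact hN h.symm
  have hcard : ∀ {z : QuadOrder D}, z ≠ 0 →
      (Submodule.cardQuot (Ideal.span {z}) = Nat.card F ^ N ↔ z.norm.natDegree = N) := by
    intro z hz
    rw [cardQuot_span_singleton hD hM hz]
    exact (Nat.pow_right_injective Finite.one_lt_card).eq_iff
  rw [← Nat.card_units, ← Nat.card_coe_set_eq, ← Nat.card_coe_set_eq, ← Nat.card_prod]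
  have hgen : ∀ K : principalIdealsOfDegree J N, ∃ z : QuadOrder D, z ∈ J ∧ z.norm.natDegree = N ∧
      Ideal.span {z} = K := by
    rintro ⟨K, hKJ, ⟨z, rfl⟩, hK⟩
    have hz : z ≠ 0 := by
      rintro rfl
      simp at hK
      exact (pow_pos Nat.card_pos N).ne hK
    exact ⟨z, hKJ (Ideal.mem_span_singleton_self z), (hcard hz).1 hK, rfl⟩
  choose z hzJ hzN hzK using hgen
  have hassoc : ∀ (u : Fˣ) (w : QuadOrder D),
      Associated w (algebraMap F[X] (QuadOrder D) (C (u : F)) * w) := fun u w =>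
    (associated_unit_mul_left w _ ((isUnit_iff hD hM).2 ⟨u, rfl⟩)).symm
  have hmem : ∀ p : Fˣ × principalIdealsOfDegree J N,
      algebraMap F[X] (QuadOrder D) (C (p.1 : F)) * z p.2 ∈
        {w | w ∈ J ∧ w.norm.natDegree = N} := by
    rintro ⟨u, K⟩
    refine ⟨J.mul_mem_left _ (hzJ K), ?_⟩
    have hne := (hassoc u (z K)).ne_zero_iff.1 (hspan (hzN K))
    rw [← hcard hne, ← Ideal.span_singleton_eq_span_singleton.2 (hassoc u (z K)),
      hcard (hspan (hzN K))]
    exact hzN K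
  symm
  refine Nat.card_eq_of_bijective (fun p => ⟨_, hmem p⟩) ⟨?_, ?_⟩
  · rintro ⟨u, K⟩ ⟨u', K'⟩ h
    replace h := congrArg Subtype.val h
    have hK : K = K' := by
      apply Subtype.ext
      rw [← hzK, ← hzK, Ideal.span_singleton_eq_span_singleton.2 (hassoc u (z K)),
        Ideal.span_singleton_eq_span_singleton.2 (hassoc u' (z K'))]
      exact congrArg (fun w => Ideal.span {w}) h
    subst hK
    have h1 := algebraMap_injective (mul_right_cancel₀ (hspan (hzN K)) h)
    exact Prod.ext (Units.ext (C_injective h1)) rfl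
  · rintro ⟨w, hwJ, hwN⟩
    have hw := hspan hwN
    obtain ⟨K, hK⟩ : ∃ K : principalIdealsOfDegree J N, (K : Ideal (QuadOrder D)) = Ideal.span {w} :=
      ⟨⟨_, (Ideal.span_singleton_le_iff_mem J).2 hwJ, ⟨w, rfl⟩, (hcard hw).2 hwN⟩, rfl⟩
    obtain ⟨v, hv⟩ := Ideal.span_singleton_eq_span_singleton.1 ((hzK K).trans hK)
    obtain ⟨u, hu⟩ := (isUnit_iff hD hM).1 v.isUnit
    refine ⟨(u, K), Subtype.ext ?_⟩
    exact (mul_comm _ _).trans ((congrArg (z K * ·) hu.symm).trans hv)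

theorem ncard_principalIdealsOfDegree [Finite F] (hD : D.Monic) (hM : Odd D.natDegree)
    {J : Ideal (QuadOrder D)} (hJ : J ≠ ⊥) {d : ℕ} (hd : Submodule.cardQuot J = Nat.card F ^ d) :
    ∃ N₀, ∀ N ≥ N₀, (principalIdealsOfDegree J (N + d)).ncard * Nat.card F ^ (D.natDegree / 2) =
      Nat.card F ^ N := by
  obtain ⟨N₀, h⟩ := ncard_natDegree_norm_eq hD hM hJ hd
  refine ⟨N₀ + 1, fun N hN => ?_⟩
  have h1 := h N (by omega)
  rw [ncard_natDegree_norm_eq_mul hD hM J (by omega), mul_assoc] at h1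
  exact Nat.eq_of_mul_eq_mul_left (Nat.sub_pos_of_lt Finite.one_lt_card) h1

end QuadOrder

namespace QuadOrder

variable {F : Type} [Field F] {D : F[X]}

/-- The presentation of the quadratic order as a quotient of `F[X][Y]`. -/
noncomputable def adjoinRootEquiv (D : F[X]) :
    AdjoinRoot ((X : F[X][X]) ^ 2 - C D) ≃ₐ[F[X]] QuadOrder D :=
  AlgEquiv.ofAlgHom
    (AdjoinRoot.liftAlgHom _ (Algebra.ofId _ _) QuadraticAlgebra.omega (by
      rw [eval₂_sub, eval₂_pow, eval₂_X, eval₂_C, pow_two, QuadraticAlgebra.omega_mul_omega_eq_add,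
        zero_smul, add_zero, Algebra.smul_def, mul_one]
      exact sub_self _))
    (QuadraticAlgebra.lift ⟨AdjoinRoot.root _, by
      have h := AdjoinRoot.eval₂_root ((X : F[X][X]) ^ 2 - C D)
      rw [eval₂_sub, eval₂_pow, eval₂_X, eval₂_C, sub_eq_zero] at h
      rw [zero_smul, add_zero, Algebra.smul_def, mul_one, ← pow_two, h]
      rfl⟩)
    (QuadraticAlgebra.algHom_ext (by simp))
    (AdjoinRoot.algHom_ext (by simp))

theorem classNumber_eq [Fintype F] [IsDomain (QuadOrder D)] :
    classNumber D = Nat.card (ClassGroup (QuadOrder D)) := by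
  have := (adjoinRootEquiv D).toMulEquiv.isDomain (QuadOrder D)
  rw [classNumber, dif_pos this]
  exact Nat.card_congr (ClassGroup.mulEquiv (adjoinRootEquiv D).toRingEquiv).toEquiv

variable [IsDedekindDomain (QuadOrder D)]

theorem exists_cardQuot_eq [Fintype F] (h2 : (2 : F) ≠ 0) (hD : D.Monic) (hM : Odd D.natDegree)
    {J : Ideal (QuadOrder D)} (hJ : J ≠ ⊥) : ∃ d, Submodule.cardQuot J = Nat.card F ^ d := by
  obtain ⟨m, hm, h⟩ := exists_mul_conjIdeal_eq h2 hD hM hJ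
  exact ⟨m.natDegree, cardQuot_of_mem_involutionFiber hD hM hm h⟩

/-- The ideals of a given class with residue ring of cardinality `q ^ n`. -/
def classIdealsOfDegree (c : ClassGroup (QuadOrder D)) (n : ℕ) : Set (Ideal (QuadOrder D)) :=
  {I | I ∈ idealsOfDegree D n ∧ ∃ h : I ∈ nonZeroDivisors (Ideal (QuadOrder D)),
    ClassGroup.mk0 ⟨I, h⟩ = c}

theorem ncard_classIdealsOfDegree [Fintype F] (h2 : (2 : F) ≠ 0) (hD : D.Monic)
    (hM : Odd D.natDegree) (c : ClassGroup (QuadOrder D)) :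
    ∃ N₀, ∀ n ≥ N₀, (classIdealsOfDegree c n).ncard * Nat.card F ^ (D.natDegree / 2) =
      Nat.card F ^ n := by
  obtain ⟨⟨J, hJ⟩, hJc⟩ := ClassGroup.mk0_surjective c⁻¹
  have hJ0 : J ≠ ⊥ := nonZeroDivisors.ne_zero hJ
  obtain ⟨d, hd⟩ := exists_cardQuot_eq h2 hD hM hJ0
  have hq : 0 < Nat.card F ^ d := pow_pos Nat.card_pos d
  obtain ⟨N₀, h⟩ := ncard_principalIdealsOfDegree hD hM hJ0 hd
  refine ⟨N₀, fun n hn => ?_⟩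
  rw [← h n hn]
  have hmul : ∀ I : Ideal (QuadOrder D), Submodule.cardQuot (I * J) = Nat.card F ^ (n + d) ↔
      I ∈ idealsOfDegree D n := by
    intro I
    rw [Submodule.cardQuot_mul_of_infinite, hd, pow_add, Nat.mul_left_inj hq.ne']
    exact Iff.rfl
  have hprin : ∀ {I : Ideal (QuadOrder D)} (hI : I ∈ nonZeroDivisors (Ideal (QuadOrder D))),
      (I * J).IsPrincipal ↔ ClassGroup.mk0 ⟨I, hI⟩ = c := by
    intro I hI
    rw [← ClassGroup.mk0_eq_one_iff (mul_mem hI hJ), ← mul_inv_eq_one (b := c), ← hJc, ← map_mul]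
    rfl
  have himage : (· * J) '' classIdealsOfDegree c n = principalIdealsOfDegree J (n + d) := by
    ext K
    constructor
    · rintro ⟨I, ⟨hIn, hI, hIc⟩, rfl⟩
      exact ⟨Ideal.mul_le_right, (hprin hI).2 hIc, (hmul I).2 hIn⟩
    · rintro ⟨hKJ, hK, hKn⟩
      obtain ⟨I, rfl⟩ := Ideal.dvd_iff_le.2 hKJ
      rw [mul_comm] at hK hKn
      have hIn := (hmul I).1 hKn
      have hI := mem_nonZeroDivisors_of_ne_zero (idealsOfDegree_ne_bot hIn)
      exact ⟨I, ⟨hIn, hI, (hprin hI).1 hK⟩, mul_comm _ _⟩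
  rw [← himage, (mul_left_injective₀ hJ0).injOn.ncard_image]

theorem eventually_sum_ncard_classIdealsOfDegree [Fintype F] (h2 : (2 : F) ≠ 0) (hD : D.Monic)
    (hM : Odd D.natDegree) (s : Finset (ClassGroup (QuadOrder D))) :
    ∀ᶠ n in Filter.atTop, (∑ c ∈ s, (classIdealsOfDegree c n).ncard) *
      Nat.card F ^ (D.natDegree / 2) = s.card * Nat.card F ^ n := by
  have h : ∀ᶠ n in Filter.atTop, ∀ c ∈ s,
      (classIdealsOfDegree c n).ncard * Nat.card F ^ (D.natDegree / 2) = Nat.card F ^ n := by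
    rw [Filter.eventually_all_finset]
    exact fun c _ => Filter.eventually_atTop.2 (ncard_classIdealsOfDegree h2 hD hM c)
  filter_upwards [h] with n hn
  rw [Finset.sum_mul, Finset.sum_congr rfl hn, Finset.sum_const, smul_eq_mul]

theorem sum_ncard_classIdealsOfDegree [Finite F] (hD : D.Monic) (hM : Odd D.natDegree)
    (s : Finset (ClassGroup (QuadOrder D))) (n : ℕ) :
    ∑ c ∈ s, (classIdealsOfDegree c n).ncard =
      {I ∈ idealsOfDegree D n | ∃ c ∈ s, I ∈ classIdealsOfDegree c n}.ncard := by
  have hfin := finite_idealsOfDegree hD hM n (D := D)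
  have hf : ∀ c : ClassGroup (QuadOrder D), (classIdealsOfDegree c n).Finite :=
    fun c => hfin.subset fun I hI => hI.1
  have hdis : (s : Set (ClassGroup (QuadOrder D))).PairwiseDisjoint fun c => (hf c).toFinset := by
    intro c _ c' _ hne
    rw [Function.onFun, Finset.disjoint_left]
    intro I hI hI'
    obtain ⟨-, h, hc⟩ := (hf c).mem_toFinset.1 hI
    obtain ⟨-, h', hc'⟩ := (hf c').mem_toFinset.1 hI'
    exact hne (hc.symm.trans hc')
  simp only [fun c => Set.ncard_eq_toFinset_card _ (hf c)]
  rw [← Finset.card_biUnion hdis, ← Set.ncard_coe_finset]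
  congr 1
  ext I
  simp only [Finset.coe_biUnion, Set.mem_iUnion, Set.Finite.coe_toFinset, Finset.mem_coe,
    exists_prop]
  exact ⟨fun ⟨c, hc, hI⟩ => ⟨hI.1, c, hc, hI⟩, fun h => h.2⟩

theorem natCard_classGroup [Fintype F] (hodd : Odd (Fintype.card F)) (h2 : (2 : F) ≠ 0)
    (hD : D.Monic) (hM : Odd D.natDegree) :
    (Nat.card (ClassGroup (QuadOrder D)) : ℝ) = (Fintype.card F : ℝ) ^ (D.natDegree / 2) *
      ∑ k ∈ Finset.range D.natDegree,
        (∑ f ∈ Mn F k, (jacobiP D f : ℝ)) * (Fintype.card F : ℝ) ^ (-(k : ℤ)) := by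
  set L := ∑ k ∈ Finset.range D.natDegree,
    (∑ f ∈ Mn F k, (jacobiP D f : ℝ)) * (Fintype.card F : ℝ) ^ (-(k : ℤ)) with hL
  have hq : (0 : ℝ) < Fintype.card F := by exact_mod_cast Fintype.card_pos
  have hcast : ∀ {a b n : ℕ}, a * Nat.card F ^ (D.natDegree / 2) = b * Nat.card F ^ n →
      (b : ℝ) * (Fintype.card F : ℝ) ^ n = a * (Fintype.card F : ℝ) ^ (D.natDegree / 2) := by
    intro a b n h
    rw [Nat.card_eq_fintype_card] at h
    exact_mod_cast h.symm
  have hle : ∀ s : Finset (ClassGroup (QuadOrder D)),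
      (s.card : ℝ) ≤ (Fintype.card F : ℝ) ^ (D.natDegree / 2) * L := by
    intro s
    obtain ⟨n, hn, hDn⟩ := ((eventually_sum_ncard_classIdealsOfDegree h2 hD hM s).and
      (Filter.eventually_ge_atTop D.natDegree)).exists
    rw [sum_ncard_classIdealsOfDegree hD hM] at hn
    refine le_of_mul_le_mul_right ?_ (pow_pos hq n)
    rw [hcast hn, mul_assoc, mul_comm L, hL, ← ncard_idealsOfDegree hodd h2 hD hM hDn, mul_comm]
    gcongr
    · exact finite_idealsOfDegree hD hM n
    · exact Set.sep_subset _ _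
  have hfin : Finite (ClassGroup (QuadOrder D)) := by
    by_contra hinf
    rw [not_finite_iff_infinite] at hinf
    obtain ⟨B, hB⟩ := exists_nat_gt ((Fintype.card F : ℝ) ^ (D.natDegree / 2) * L)
    obtain ⟨s, rfl⟩ := Infinite.exists_subset_card_eq (ClassGroup (QuadOrder D)) B
    exact (hle s).not_gt hB
  have := Fintype.ofFinite (ClassGroup (QuadOrder D))
  obtain ⟨n, hn, hDn⟩ := ((eventually_sum_ncard_classIdealsOfDegree h2 hD hM Finset.univ).and
    (Filter.eventually_ge_atTop D.natDegree)).exists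
  have huniv : {I ∈ idealsOfDegree D n | ∃ c ∈ Finset.univ, I ∈ classIdealsOfDegree c n} =
      idealsOfDegree D n := by
    refine Set.sep_eq_self_iff_mem_true.2 fun I hI => ?_
    have hI0 := mem_nonZeroDivisors_of_ne_zero (idealsOfDegree_ne_bot hI)
    exact ⟨_, Finset.mem_univ _, hI, hI0, rfl⟩
  rw [sum_ncard_classIdealsOfDegree hD hM, huniv, Finset.card_univ] at hn
  refine mul_right_cancel₀ (pow_pos hq n).ne' ?_
  rw [Nat.card_eq_fintype_card, hcast hn, ncard_idealsOfDegree hodd h2 hD hM hDn]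
  ring

end QuadOrder

/-- Artin. For `q` odd and `D` monic square-free of odd degree `M`,
`L(1,χ_D) = (√q/√|D|) h_D`, where `h_D = |Pic(𝔽_q[T][√D])|` and `|D| = q^M`. Here
`L(1,χ_D) = ∑_{n=0}^{M-1} (∑_{f monic, deg f = n} χ_D(f)) q^{-n}`. -/
theorem artin_class_number_formula (F : Type) [Field F] [Fintype F]
    (hodd : Odd (Fintype.card F)) (D : Polynomial F)
    (hD : D.Monic) (hsf : Squarefree D) (hM : Odd D.natDegree) :
    ∑ n ∈ Finset.range D.natDegree,
        (∑ f ∈ Mn F n, (jacobiP D f : ℝ)) * (Fintype.card F : ℝ) ^ (-(n : ℤ))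
      = Real.sqrt (Fintype.card F) / Real.sqrt ((Fintype.card F : ℝ) ^ D.natDegree) *
          (classNumber D : ℝ) := by
  have h2 : (2 : F) ≠ 0 := Ring.two_ne_zero fun h => by
    have := FiniteField.even_card_of_char_two h
    exact (Nat.not_even_iff_odd.2 hodd) (Nat.even_iff.2 this)
  have := QuadOrder.isDomain hD hM
  have := QuadOrder.isDedekindDomain h2 hD hsf hM
  have hq : (0 : ℝ) < Fintype.card F := by exact_mod_cast Fintype.card_pos
  rw [QuadOrder.classNumber_eq, QuadOrder.natCard_classGroup hodd h2 hD hM, ← mul_assoc]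
  have hpow : (Fintype.card F : ℝ) ^ D.natDegree =
      Fintype.card F * ((Fintype.card F : ℝ) ^ (D.natDegree / 2)) ^ 2 := by
    rw [← pow_mul, ← pow_succ']
    congr 1
    have := Nat.odd_iff.1 hM
    omega
  rw [hpow, Real.sqrt_mul hq.le, Real.sqrt_sq (pow_pos hq _).le]
  have h1 : Real.sqrt (Fintype.card F) ≠ 0 := (Real.sqrt_pos.2 hq).ne'
  have h3 : (Fintype.card F : ℝ) ^ (D.natDegree / 2) ≠ 0 := (pow_pos hq _).ne'
  field_simp
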